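/- Assume r ∈ ℂ, α, β ∈ BV_loc((a,b),ℂ), supp(dα) = (a,b), and θ_{1−r}(x) ≠ 0 and θ_r(x) ≠ 0 for all x ∈ (a,b), where θ_z(x) = 1 − z² Δ_{dα}(x) Δ_{dβ}(x). Let η ∈ BV_loc((a,b),ℂ). Then for every x₀ ∈ (a,b) and A, B ∈ ℂ, the initial value problem −d(dy/dα) + y dβ = dη, y(x₀) = A, (dy/dα)(x₀) = B has a unique r-balanced solution. If in addition r, α, β, η, A and B are real, then the solution is real. -/

import Mathlib

open Set Filter Function MeasureTheory Topology

noncomputable section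

/-- The open interval `(a,b) ⊆ ℝ` determined by extended-real endpoints `a`, `b`. -/
def EI (a b : EReal) : Set ℝ := {x : ℝ | a < (x : EReal) ∧ (x : EReal) < b}

/-- The jump `Δ_{df}(x) = f⁺(x) - f⁻(x)` of a real-valued function. -/
def jump (f : ℝ → ℝ) (x : ℝ) : ℝ := rightLim f x - leftLim f x

/-- The jump `Δ_{df}(x) = f⁺(x) - f⁻(x)` of a complex-valued function. -/
def jumpC (f : ℝ → ℂ) (x : ℝ) : ℂ := rightLim f x - leftLim f x

/-- `θ_z(x) = 1 - z² Δ_{dα}(x) Δ_{dβ}(x)`. -/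
def theta (α β : ℝ → ℝ) (z x : ℝ) : ℝ := 1 - z ^ 2 * jump α x * jump β x

/-- `ω(x) = 1 - Δ_{dα}(x) Δ_{dβ}(x) / 4`. -/
def omegaFn (α β : ℝ → ℝ) (x : ℝ) : ℝ := 1 - jump α x * jump β x / 4

/-- A real-valued function is `r`-balanced on `I`: it is of locally bounded variation and
`f(x) = r f⁻(x) + (1-r) f⁺(x)` for all `x ∈ I`. -/
def RBalanced (r : ℝ) (I : Set ℝ) (f : ℝ → ℝ) : Prop :=
  LocallyBoundedVariationOn f I ∧
    ∀ x ∈ I, f x = r * leftLim f x + (1 - r) * rightLim f x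

/-- A complex-valued function is `r`-balanced on `I`. -/
def RBalancedC (r : ℂ) (I : Set ℝ) (f : ℝ → ℂ) : Prop :=
  LocallyBoundedVariationOn f I ∧
    ∀ x ∈ I, f x = r * leftLim f x + (1 - r) * rightLim f x

/-- `ν` coincides on `[c,d]` with the Lebesgue–Stieltjes measure `df` generated by `f`,
determined by `df((x,y]) = f⁺(y) - f⁺(x)`. -/
def SMRepresents (ν : SignedMeasure ℝ) (f : ℝ → ℝ) (c d : ℝ) : Prop :=
  ∀ x ∈ Icc c d, ∀ y ∈ Icc c d, x ≤ y → ν (Ioc x y) = rightLim f y - rightLim f x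

/-- The integral of `h` against the signed measure `ν` over the set `E`. -/
def sInt (ν : SignedMeasure ℝ) (h : ℝ → ℝ) (E : Set ℝ) : ℝ :=
  (∫ x in E, h x ∂ν.toJordanDecomposition.posPart) -
    (∫ x in E, h x ∂ν.toJordanDecomposition.negPart)

/-- The equality of (locally finite, real Borel) measures `dg = ∑ j, (h j) d(β j)` on the
interval `I`, expressed via localizations to compact subintervals of `I`. -/
def MeasureEqOn (I : Set ℝ) {ι : Type} [Fintype ι] (g : ℝ → ℝ) (h β : ι → ℝ → ℝ) : Prop :=
  ∀ c ∈ I, ∀ d ∈ I, c < d →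
    ∃ (νg : SignedMeasure ℝ) (ν : ι → SignedMeasure ℝ),
      SMRepresents νg g c d ∧ (∀ j, SMRepresents (ν j) (β j) c d) ∧
      ∀ E : Set ℝ, E ⊆ Ioc c d → MeasurableSet E → νg E = ∑ j, sInt (ν j) (h j) E

/-- The equality of complex measures `dg = ∑ j, (h j) d(β j)` on `I`, encoded via real and
imaginary parts. -/
def MeasureEqOnC (I : Set ℝ) {ι : Type} [Fintype ι] (g : ℝ → ℂ) (h β : ι → ℝ → ℂ) : Prop :=
  MeasureEqOn I (fun x => (g x).re)
    (Sum.elim (fun j x => (h j x).re) (fun j x => -(h j x).im))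
    (Sum.elim (fun j x => (β j x).re) (fun j x => (β j x).im)) ∧
  MeasureEqOn I (fun x => (g x).im)
    (Sum.elim (fun j x => (h j x).im) (fun j x => (h j x).re))
    (Sum.elim (fun j x => (β j x).re) (fun j x => (β j x).im))

/-- The support of `dα` is all of `I`: no open subinterval of `I` is `dα`-null, i.e. on no
open subinterval of `I` do all one-sided limits of `α` coincide with a single constant. -/
def SuppFull (I : Set ℝ) (α : ℝ → ℂ) : Prop :=
  ∀ x ∈ I, ∀ ε > (0 : ℝ), Icc (x - ε) (x + ε) ⊆ I →
    ¬ (∀ p ∈ Ioo (x - ε) (x + ε), ∀ q ∈ Ioo (x - ε) (x + ε),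
        rightLim α p = rightLim α q ∧ leftLim α p = rightLim α q)

/-- `u`, together with the representative `w` of `du/dα`, is an `r`-balanced solution of the
homogeneous equation `-d(du/dα) + u dβ = 0` on `I`: `u` and `w` are `r`-balanced,
`du = w dα` (so `du ≪ dα` with `du/dα = w`), and `dw = u dβ`. -/
def IsHomSol (I : Set ℝ) (r : ℝ) (α β u w : ℝ → ℝ) : Prop :=
  RBalanced r I u ∧ RBalanced r I w ∧
  MeasureEqOn I u (fun _ : Fin 1 => w) (fun _ => α) ∧
  MeasureEqOn I w (fun _ : Fin 1 => u) (fun _ => β)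

/-- `u`, together with the representative `w` of `du/dα`, is an `r`-balanced solution of
`-d(du/dα) + u dβ = dη` on `I` (complex-valued coefficients): `dw = u dβ - dη`. -/
def IsSolC (I : Set ℝ) (r : ℂ) (α β η u w : ℝ → ℂ) : Prop :=
  RBalancedC r I u ∧ RBalancedC r I w ∧
  MeasureEqOnC I u (fun _ : Fin 1 => w) (fun _ => α) ∧
  MeasureEqOnC I w ![u, fun _ => (-1 : ℂ)] ![β, η]

/-- `y` solves the linear system `dy = dφ · y + dψ` on `I`, componentwise:
`d(y i) = ∑ j, (y j) d(φ i j) + dψ i`. -/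
def IsSysSolC (I : Set ℝ) (n : ℕ) (φ : ℝ → Matrix (Fin n) (Fin n) ℂ)
    (ψ : ℝ → Fin n → ℂ) (y : ℝ → Fin n → ℂ) : Prop :=
  ∀ i : Fin n,
    MeasureEqOnC I (fun x => y x i)
      (Sum.elim (fun j : Fin n => fun x => y x j) (fun _ : Unit => fun _ => (1 : ℂ)))
      (Sum.elim (fun j : Fin n => fun x => φ x i j) (fun _ : Unit => fun x => ψ x i))

/-- `Z_I(f) = {x ∈ I : f⁻(x) f⁺(x) ≤ 0}`, the set of sign-changing points of `f` in `I`. -/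
def ZSet (f : ℝ → ℝ) (I : Set ℝ) : Set ℝ := {x ∈ I | leftLim f x * rightLim f x ≤ 0}

/-- `u` changes sign at `s ∈ I`. -/
def ChangesSignAt (I : Set ℝ) (u : ℝ → ℝ) (s : ℝ) : Prop :=
  ∃ δ > (0 : ℝ), Ioo (s - δ) (s + δ) ⊆ I ∧
    (((∀ x ∈ Ioo (s - δ) s, leftLim u x < 0) ∧ ∀ x ∈ Ioo s (s + δ), 0 < rightLim u x) ∨
     ((∀ x ∈ Ioo (s - δ) s, 0 < leftLim u x) ∧ ∀ x ∈ Ioo s (s + δ), rightLim u x < 0))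

/-- `u` changes sign in `J` (a subinterval of `I`). -/
def ChangesSignIn (I : Set ℝ) (u : ℝ → ℝ) (J : Set ℝ) : Prop :=
  ∃ s ∈ J, ChangesSignAt I u s

/-- `u` and `v` are linearly dependent on `I`. -/
def LinDepOn (I : Set ℝ) (u v : ℝ → ℝ) : Prop :=
  ∃ c₁ c₂ : ℝ, ¬(c₁ = 0 ∧ c₂ = 0) ∧ ∀ x ∈ I, c₁ * u x + c₂ * v x = 0

/-- The Lebesgue–Stieltjes measure `dg` is nonnegative on (Borel subsets of) `S`, expressed by
nonnegativity on all subintervals of `S` of each of the four kinds. -/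
def PosMeasureOn (g : ℝ → ℝ) (S : Set ℝ) : Prop :=
  (∀ x y : ℝ, x ≤ y → Icc x y ⊆ S → 0 ≤ rightLim g y - leftLim g x) ∧
  (∀ x y : ℝ, x ≤ y → Ico x y ⊆ S → 0 ≤ leftLim g y - leftLim g x) ∧
  (∀ x y : ℝ, x ≤ y → Ioc x y ⊆ S → 0 ≤ rightLim g y - rightLim g x) ∧
  (∀ x y : ℝ, x < y → Ioo x y ⊆ S → 0 ≤ leftLim g y - rightLim g x)


/-- `y` is strongly measurable and bounded. -/
def BddMeas {X E : Type*} [MeasurableSpace X] [NormedAddCommGroup E] (y : X → E) : Prop :=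
  StronglyMeasurable y ∧ ∃ C : ℝ, ∀ t, ‖y t‖ ≤ C

theorem exists_fixedPoint_of_weight {X E : Type*} [MeasurableSpace X] [NormedAddCommGroup E]
    [CompleteSpace E] {ρ : X → ℝ} {R : ℝ} (hρ : ∀ t, 1 ≤ ρ t) (hR : ∀ t, ρ t ≤ R)
    {Φ : (X → E) → X → E} (hΦ : ∀ y, BddMeas y → BddMeas (Φ y))
    (hc : ∀ y y' C, BddMeas y → BddMeas y' → (∀ t, ‖y t - y' t‖ ≤ C * ρ t) →
      ∀ t, ‖Φ y t - Φ y' t‖ ≤ 1 / 2 * (C * ρ t)) :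
    ∃ y, BddMeas y ∧ Φ y = y := by
  have h0 : BddMeas (0 : X → E) := ⟨stronglyMeasurable_zero, 0, fun t => by simp⟩
  obtain ⟨C, hC⟩ := (hΦ 0 h0).2
  let Y : ℕ → X → E := fun n => Φ^[n] 0
  have hYs : ∀ n, Y (n + 1) = Φ (Y n) := fun n => iterate_succ_apply' Φ n 0
  have hY : ∀ n, BddMeas (Y n) := by
    intro n
    induction n with
    | zero => exact h0
    | succ n ih => rw [hYs]; exact hΦ _ ih
  have hstep : ∀ n t, ‖Y n t - Y (n + 1) t‖ ≤ |C| * (1 / 2) ^ n * ρ t := by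
    intro n
    induction n with
    | zero =>
      intro t
      have h1 : ‖Φ 0 t‖ ≤ |C| := (hC t).trans (le_abs_self C)
      have : Y 1 = Φ 0 := rfl
      simp only [zero_add, this, pow_zero, mul_one]
      change ‖(0 : E) - Φ 0 t‖ ≤ _
      rw [zero_sub, norm_neg]
      nlinarith [hρ t, abs_nonneg C]
    | succ n ih =>
      intro t
      rw [hYs n, hYs (n + 1)]
      refine (hc _ _ _ (hY n) (hY (n + 1)) ih t).trans (le_of_eq ?_)
      ring
  have hdist : ∀ t n, dist (Y n t) (Y (n + 1) t) ≤ |C| * ρ t * (1 / 2) ^ n := by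
    intro t n
    rw [dist_eq_norm]
    exact (hstep n t).trans (le_of_eq (by ring))
  have hlim : ∀ t, ∃ l, Tendsto (fun n => Y n t) atTop (𝓝 l) := fun t =>
    cauchySeq_tendsto_of_complete (cauchySeq_of_le_geometric (1 / 2) _ (by norm_num) (hdist t))
  choose y hy using hlim
  have hclose : ∀ n t, ‖Y n t - y t‖ ≤ 2 * |C| * (1 / 2) ^ n * ρ t := by
    intro n t
    rw [← dist_eq_norm]
    refine (dist_le_of_le_geometric_of_tendsto (1 / 2) _ (by norm_num) (hdist t) (hy t) n).trans
      (le_of_eq (by ring))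
  have hyB : BddMeas y := by
    refine ⟨stronglyMeasurable_of_tendsto atTop (fun n => (hY n).1) (tendsto_pi_nhds.2 hy),
      2 * |C| * R, fun t => ?_⟩
    have := hclose 0 t
    have h2 : Y 0 t = 0 := rfl
    rw [h2, zero_sub, norm_neg, pow_zero, mul_one] at this
    exact this.trans (mul_le_mul_of_nonneg_left (hR t) (by positivity))
  refine ⟨y, hyB, funext fun t => ?_⟩
  have h1 : Tendsto (fun n => Y (n + 1) t) atTop (𝓝 (y t)) := (hy t).comp (tendsto_add_atTop_nat 1)
  refine tendsto_nhds_unique ?_ h1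
  rw [tendsto_iff_norm_sub_tendsto_zero]
  have hz : Tendsto (fun n : ℕ => 1 / 2 * (2 * |C| * (1 / 2 : ℝ) ^ n * ρ t)) atTop (𝓝 0) := by
    have := (tendsto_pow_atTop_nhds_zero_of_lt_one (r := (1 / 2 : ℝ)) (by norm_num)
      (by norm_num)).const_mul (2 * |C|)
    have h2 := (this.mul_const (ρ t)).const_mul (1 / 2)
    rwa [mul_zero, zero_mul, mul_zero] at h2
  refine squeeze_zero (fun _ => norm_nonneg _) (fun n => ?_) hz
  rw [hYs]
  exact hc _ _ _ (hY n) hyB (hclose n) t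

theorem integral_exp_le_of_distribution {X : Type*} [MeasurableSpace X] {μ : Measure X}
    [IsFiniteMeasure μ] {V : X → ℝ} (hV : Measurable V) (hV0 : ∀ s, 0 ≤ V s) {M l : ℝ}
    (hl : 0 < l) (hM : μ.real univ = M) (hVM : ∀ s, V s ≤ M)
    (hd : ∀ v, 0 ≤ v → μ {s | v < V s} ≤ ENNReal.ofReal (M - v)) :
    ∫ s, Real.exp (l * V s) ∂μ ≤ Real.exp (l * M) / l := by
  have hM0 : 0 ≤ M := hM ▸ measureReal_nonneg
  have hint : Integrable (fun s => Real.exp (l * V s)) μ := by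
    refine Integrable.of_bound (by fun_prop) (Real.exp (l * M)) (ae_of_all _ fun s => ?_)
    rw [Real.norm_eq_abs, Real.abs_exp]
    exact Real.exp_le_exp.2 (mul_le_mul_of_nonneg_left (hVM s) hl.le)
  have hprim : ∀ x : ℝ, ∫ t in (0 : ℝ)..x, l * Real.exp (l * t) = Real.exp (l * x) - 1 := by
    intro x
    have hder : ∀ t ∈ uIcc 0 x, HasDerivAt (fun t => Real.exp (l * t)) (l * Real.exp (l * t)) t := by
      intro t _
      have := ((hasDerivAt_id t).const_mul l).exp
      simpa [mul_comm] using this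
    rw [intervalIntegral.integral_eq_sub_of_hasDerivAt hder
      (Continuous.intervalIntegrable (by fun_prop) _ _)]
    simp
  have hlc := lintegral_comp_eq_lintegral_meas_lt_mul μ (f := V) (g := fun t => l * Real.exp (l * t))
    (ae_of_all _ hV0) hV.aemeasurable
    (fun t _ => Continuous.intervalIntegrable (by fun_prop) _ _)
    (ae_of_all _ fun t => by positivity)
  simp only [hprim] at hlc
  have hbound : ∫⁻ t in Ioi (0 : ℝ), μ {a | t < V a} * ENNReal.ofReal (l * Real.exp (l * t)) ≤
      ENNReal.ofReal ((Real.exp (l * M) - 1) / l - M) := by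
    have h1 : ∀ t ∈ Ioi (0 : ℝ), μ {a | t < V a} * ENNReal.ofReal (l * Real.exp (l * t)) ≤
        (Ioc 0 M).indicator (fun t => ENNReal.ofReal ((M - t) * (l * Real.exp (l * t)))) t := by
      intro t ht
      by_cases htM : t ≤ M
      · rw [indicator_of_mem (show t ∈ Ioc 0 M from ⟨ht, htM⟩),
          ENNReal.ofReal_mul (p := M - t) (by linarith)]
        exact mul_le_mul_left (hd t (le_of_lt ht)) _
      · have : {a | t < V a} = ∅ := by
          ext s; simp only [mem_ofPred_eq, mem_empty_iff_false, iff_false, not_lt]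
          exact (hVM s).trans (not_le.1 htM).le
        rw [this]; simp
    refine (setLIntegral_mono' measurableSet_Ioi h1).trans ?_
    refine (setLIntegral_le_lintegral _ _).trans ?_
    rw [lintegral_indicator measurableSet_Ioc, ← ofReal_integral_eq_lintegral_ofReal]
    · rw [← intervalIntegral.integral_of_le hM0]
      apply ENNReal.ofReal_le_ofReal
      have hder : ∀ t ∈ uIcc 0 M, HasDerivAt
          (fun t => (M - t) * Real.exp (l * t) + Real.exp (l * t) / l)
          ((M - t) * (l * Real.exp (l * t))) t := by
        intro t _
        have he : HasDerivAt (fun t => Real.exp (l * t)) (l * Real.exp (l * t)) t := by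
          simpa [mul_comm] using ((hasDerivAt_id t).const_mul l).exp
        have := (((hasDerivAt_id t).const_sub M).mul he).add (he.div_const l)
        refine this.congr_deriv ?_
        have hl' : l * Real.exp (l * t) / l = Real.exp (l * t) := by field_simp
        rw [hl']
        simp only [id_eq]
        ring
      rw [intervalIntegral.integral_eq_sub_of_hasDerivAt hder
        (Continuous.intervalIntegrable (by fun_prop) _ _)]
      apply le_of_eq
      simp
      ring
    · exact (Continuous.integrableOn_Icc (by fun_prop)).mono_set Ioc_subset_Icc_self
    · refine (ae_restrict_iff' measurableSet_Ioc).2 (ae_of_all _ fun t ht => ?_)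
      have := ht.2
      have : 0 ≤ M - t := by linarith
      simp only [Pi.zero_apply]
      positivity
  rw [← hlc, ← ofReal_integral_eq_lintegral_ofReal
    (f := fun s => Real.exp (l * V s) - 1) (hint.sub (integrable_const 1))
    (ae_of_all _ fun s => by
      have : 1 ≤ Real.exp (l * V s) := Real.one_le_exp (mul_nonneg hl.le (hV0 s))
      simpa using this)] at hbound
  have hnn : 0 ≤ (Real.exp (l * M) - 1) / l - M := by
    have := Real.add_one_le_exp (l * M)
    rw [sub_nonneg, le_div_iff₀ hl]; linarith
  rw [ENNReal.ofReal_le_ofReal_iff hnn, integral_sub hint (integrable_const 1)] at hbound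
  simp only [integral_const, hM, smul_eq_mul, mul_one] at hbound
  rw [sub_div] at hbound
  have : 0 ≤ 1 / l := by positivity
  linarith

/-- The open interval with endpoints `x₀` and `t`, in either order. -/
def between (x₀ t : ℝ) : Set ℝ := Ioo x₀ t ∪ Ioo t x₀

theorem measure_lt_measure_Ioo_le (m : Measure ℝ) [IsFiniteMeasure m] (x₀ t v : ℝ) :
    m {s | s ∈ Ioo x₀ t ∧ v < m.real (Ioo x₀ s)} ≤ ENNReal.ofReal (m.real (Ioo x₀ t) - v) := by
  set U := {s | s ∈ Ioo x₀ t ∧ v < m.real (Ioo x₀ s)} with hU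
  rcases U.eq_empty_or_nonempty with h | h
  · simp [h]
  have hb : BddBelow U := ⟨x₀, fun s hs => hs.1.1.le⟩
  obtain ⟨p, hp, -, hpt, hpU⟩ := (isGLB_csInf h hb).exists_seq_antitone_tendsto h
  have hup : ∀ {s s'}, s ∈ U → s ≤ s' → s' < t → s' ∈ U := fun {s s'} hs hss hst =>
    ⟨⟨hs.1.1.trans_le hss, hst⟩, hs.2.trans_le
      (measureReal_mono (Ioo_subset_Ioo_right hss))⟩
  have hpiece : ∀ s ∈ U, m (Ico s t) ≤ ENNReal.ofReal (m.real (Ioo x₀ t) - v) := by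
    intro s hs
    have h1 : m.real (Ioo x₀ t) = m.real (Ioo x₀ s) + m.real (Ico s t) := by
      rw [← measureReal_union _ measurableSet_Ico, Ioo_union_Ico_eq_Ioo hs.1.1 hs.1.2.le]
      exact Set.disjoint_left.2 fun y hy hy' => (hy.2.trans_le hy'.1).false
    rw [← ofReal_measureReal]
    apply ENNReal.ofReal_le_ofReal
    have := hs.2
    linarith
  by_cases hmem : sInf U ∈ U
  · refine (measure_mono ?_).trans (hpiece _ hmem)
    exact fun s hs => ⟨csInf_le hb hs, hs.1.2⟩
  · have hUeq : U ⊆ ⋃ n, Ico (p n) t := by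
      intro s hs
      have hlt : sInf U < s := lt_of_le_of_ne (csInf_le hb hs) (fun h => hmem (h ▸ hs))
      obtain ⟨n, hn⟩ := (hpt.eventually (gt_mem_nhds hlt)).exists
      exact mem_iUnion.2 ⟨n, hn.le, hs.1.2⟩
    refine (measure_mono hUeq).trans ?_
    rw [Monotone.measure_iUnion fun i j hij => Ico_subset_Ico_left (hp hij)]
    exact iSup_le fun n => hpiece _ (hpU n)

theorem measurable_measureReal_Ioo_right (m : Measure ℝ) [IsFiniteMeasure m] (x₀ : ℝ) :
    Measurable fun s => m.real (Ioo x₀ s) :=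
  Monotone.measurable fun _ _ h => measureReal_mono (Ioo_subset_Ioo_right h)

theorem measurable_measureReal_Ioo_left (m : Measure ℝ) [IsFiniteMeasure m] (x₀ : ℝ) :
    Measurable fun s => m.real (Ioo s x₀) :=
  Antitone.measurable fun _ _ h => measureReal_mono (Ioo_subset_Ioo_left h)

theorem setIntegral_exp_measure_Ioo_right_le (m : Measure ℝ) [IsFiniteMeasure m] (x₀ t : ℝ)
    {l : ℝ} (hl : 0 < l) :
    ∫ s in Ioo x₀ t, Real.exp (l * m.real (Ioo x₀ s)) ∂m ≤
      Real.exp (l * m.real (Ioo x₀ t)) / l := by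
  have h := integral_exp_le_of_distribution (μ := m.restrict (Ioo x₀ t))
    (V := fun s => m.real (Ioo x₀ (min s t))) (M := m.real (Ioo x₀ t))
    ((measurable_measureReal_Ioo_right m x₀).comp (measurable_id.min measurable_const))
    (fun s => measureReal_nonneg) hl (by simp [measureReal_def])
    (fun s => measureReal_mono (Ioo_subset_Ioo_right (min_le_right _ _)))
    (fun v _ => ?_)
  · refine le_trans (le_of_eq (setIntegral_congr_fun measurableSet_Ioo fun s hs => ?_)) h
    simp only [min_eq_left hs.2.le]
  · rw [Measure.restrict_apply' measurableSet_Ioo]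
    refine (measure_mono ?_).trans (measure_lt_measure_Ioo_le m x₀ t v)
    rintro s ⟨hs, hs'⟩
    refine ⟨hs', ?_⟩
    rwa [mem_ofPred_eq, min_eq_left hs'.2.le] at hs

theorem setIntegral_exp_measure_Ioo_left_le (m : Measure ℝ) [IsFiniteMeasure m] (x₀ t : ℝ)
    {l : ℝ} (hl : 0 < l) :
    ∫ s in Ioo t x₀, Real.exp (l * m.real (Ioo s x₀)) ∂m ≤
      Real.exp (l * m.real (Ioo t x₀)) / l := by
  have hmap : ∀ p q : ℝ, (m.map (fun x : ℝ => -x)).real (Ioo p q) = m.real (Ioo (-q) (-p)) := by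
    intro p q
    rw [map_measureReal_apply measurable_neg measurableSet_Ioo]
    simp
  have h := setIntegral_exp_measure_Ioo_right_le (m.map (fun x : ℝ => -x)) (-x₀) (-t) hl
  simp only [hmap, neg_neg] at h
  have hneg : MeasurableEmbedding (fun x : ℝ => -x) := (MeasurableEquiv.neg ℝ).measurableEmbedding
  rw [hneg.setIntegral_map] at h
  simpa using h

theorem exists_weight (m : Measure ℝ) [IsFiniteMeasure m] {f : ℝ → ℝ} (hf0 : ∀ s, 0 ≤ f s)
    (hf : Integrable f m) (hfm : Measurable f) (x₀ : ℝ) {K : ℝ} (hK : 0 < K) :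
    ∃ (ρ : ℝ → ℝ) (R : ℝ), Measurable ρ ∧ (∀ t, 1 ≤ ρ t) ∧ (∀ t, ρ t ≤ R) ∧
      ∀ t, K * ∫ s in between x₀ t, f s * ρ s ∂m ≤ 1 / 2 * ρ t := by
  set m₁ := m.withDensity (fun s => ENNReal.ofReal (f s)) with hm₁
  have : IsFiniteMeasure m₁ := isFiniteMeasure_withDensity_ofReal hf.2
  have h2K : 0 < 2 * K := by positivity
  have hbr : ∀ {t}, x₀ ≤ t → between x₀ t = Ioo x₀ t := fun {t} h => by
    simp [between, Ioo_eq_empty (not_lt.2 h)]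
  have hbl : ∀ {t}, t ≤ x₀ → between x₀ t = Ioo t x₀ := fun {t} h => by
    simp [between, Ioo_eq_empty (not_lt.2 h)]
  have hmeas : Measurable fun t => m₁.real (between x₀ t) := by
    have : (fun t => m₁.real (between x₀ t)) =
        fun t => m₁.real (Ioo x₀ t) + m₁.real (Ioo t x₀) := by
      funext t
      rcases le_total x₀ t with h | h
      · simp [hbr h, Ioo_eq_empty (not_lt.2 h)]
      · simp [hbl h, Ioo_eq_empty (not_lt.2 h)]
    rw [this]
    exact (measurable_measureReal_Ioo_right _ _).add (measurable_measureReal_Ioo_left _ _)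
  refine ⟨fun t => Real.exp (2 * K * m₁.real (between x₀ t)),
    Real.exp (2 * K * m₁.real univ), by fun_prop, fun t => ?_, fun t => ?_, fun t => ?_⟩
  · exact Real.one_le_exp (by positivity)
  · exact Real.exp_le_exp.2 (mul_le_mul_of_nonneg_left (measureReal_mono (subset_univ _)) h2K.le)
  · have hconv : ∀ (S : Set ℝ) (g : ℝ → ℝ), MeasurableSet S →
        ∫ s in S, f s * g s ∂m = ∫ s in S, g s ∂m₁ := by
      intro S g hS
      rw [hm₁, setIntegral_withDensity_eq_setIntegral_toReal_smul (by fun_prop)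
        (ae_of_all _ fun s => ENNReal.ofReal_lt_top) _ hS]
      simp [ENNReal.toReal_ofReal (hf0 _)]
    suffices h : ∫ s in between x₀ t, Real.exp (2 * K * m₁.real (between x₀ s)) ∂m₁ ≤
        Real.exp (2 * K * m₁.real (between x₀ t)) / (2 * K) by
      rw [hconv (between x₀ t) _ (measurableSet_Ioo.union measurableSet_Ioo)]
      refine (mul_le_mul_of_nonneg_left h hK.le).trans (le_of_eq ?_)
      field_simp
    rcases le_total x₀ t with h | h
    · rw [hbr h]
      refine le_trans (le_of_eq (setIntegral_congr_fun measurableSet_Ioo fun s hs => ?_))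
        (setIntegral_exp_measure_Ioo_right_le m₁ x₀ t h2K)
      simp only [hbr hs.1.le]
    · rw [hbl h]
      refine le_trans (le_of_eq (setIntegral_congr_fun measurableSet_Ioo fun s hs => ?_))
        (setIntegral_exp_measure_Ioo_left_le m₁ x₀ t h2K)
      simp only [hbl hs.2.le]

theorem atom_eq_integral (m : Measure ℝ) [IsFiniteMeasure m] (f : ℝ → ℂ) (t : ℝ) :
    ∫ s in {t}, f s ∂m = f t * m.real {t} := by
  rw [integral_singleton, Complex.real_smul, mul_comm]

theorem norm_atom_le (m : Measure ℝ) [IsFiniteMeasure m] {f : ℝ → ℂ} (hf : Integrable f m)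
    (t : ℝ) : ‖f t * m.real {t}‖ ≤ ∫ s, ‖f s‖ ∂m := by
  rw [← atom_eq_integral]
  exact (norm_integral_le_integral_norm _).trans
    (setIntegral_le_integral hf.norm (ae_of_all _ fun _ => norm_nonneg _))

theorem finite_large_atoms (m : Measure ℝ) [IsFiniteMeasure m] {f : ℝ → ℂ}
    (hf : Integrable f m) {ε : ℝ} (hε : 0 < ε) : {t | ε ≤ ‖f t * m.real {t}‖}.Finite := by
  set m₁ := m.withDensity (fun s => ‖f s‖ₑ)
  have h1 : m₁ univ ≠ ⊤ := by
    rw [withDensity_apply _ MeasurableSet.univ, Measure.restrict_univ]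
    exact hf.2.ne
  refine (Measure.finite_const_le_meas_of_disjoint_iUnion m₁ (ε := ENNReal.ofReal ε)
    (by simpa using hε) (As := fun t : ℝ => {t}) (fun t => measurableSet_singleton t)
    (fun s t h => by simpa [onFun] using h)
    (measure_ne_top_of_subset (subset_univ _) h1)).subset ?_
  intro t ht
  have h2 : m₁ {t} = ENNReal.ofReal ‖f t * m.real {t}‖ := by
    rw [withDensity_apply _ (measurableSet_singleton t), lintegral_singleton, norm_mul,
      ENNReal.ofReal_mul (norm_nonneg _), ofReal_norm, Complex.norm_real,
      Real.norm_of_nonneg measureReal_nonneg, ofReal_measureReal]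
  simp only [mem_ofPred_eq] at ht ⊢
  rw [h2]
  exact ENNReal.ofReal_le_ofReal ht

/-- The `r`-balanced primitive of the measure with density `h` with respect to `m`. -/
def balPrim (m : Measure ℝ) (r : ℂ) (h : ℝ → ℂ) (t : ℝ) : ℂ :=
  r * ∫ s in Iio t, h s ∂m + (1 - r) * ∫ s in Iic t, h s ∂m

/-- The function equal to `p` to the right of `x₀`, to `q` to the left of it and to `0` at `x₀`. -/
def sideSelect (x₀ : ℝ) (p q : ℂ) (t : ℝ) : ℂ := if x₀ < t then p else if t < x₀ then q else 0

theorem measurable_sideSelect (x₀ : ℝ) (p q : ℂ) : Measurable (sideSelect x₀ p q) :=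
  Measurable.ite measurableSet_Ioi measurable_const
    (Measurable.ite measurableSet_Iio measurable_const measurable_const)

theorem norm_sideSelect_le (x₀ : ℝ) (p q : ℂ) (t : ℝ) : ‖sideSelect x₀ p q t‖ ≤ ‖p‖ + ‖q‖ := by
  unfold sideSelect
  split_ifs
  · linarith [norm_nonneg q]
  · linarith [norm_nonneg p]
  · simp only [norm_zero]; positivity

theorem balPrim_sub (m : Measure ℝ) [IsFiniteMeasure m] (r : ℂ) {h : ℝ → ℂ}
    (hh : Integrable h m) (x₀ t : ℝ) :
    balPrim m r h t - balPrim m r h x₀ =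
      sideSelect x₀ (1 - r) (-r) t * (h t * m.real {t}) +
      sideSelect x₀ r (-(1 - r)) t * (h x₀ * m.real {x₀}) +
      sideSelect x₀ 1 (-1) t * ∫ s in between x₀ t, h s ∂m := by
  have hIic : ∀ t, ∫ s in Iic t, h s ∂m = (∫ s in Iio t, h s ∂m) + h t * m.real {t} := by
    intro t
    rw [← atom_eq_integral, ← setIntegral_union (by simp) (measurableSet_singleton t)
      hh.integrableOn hh.integrableOn, Iio_union_right]
  have hIio : ∀ {p q}, p < q → ∫ s in Iio q, h s ∂m =
      (∫ s in Iio p, h s ∂m) + h p * m.real {p} + ∫ s in Ioo p q, h s ∂m := by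
    intro p q hpq
    rw [← hIic, ← setIntegral_union (Set.disjoint_left.2 fun y (hy : y ∈ Iic p)
      (hy' : y ∈ Ioo p q) => (hy'.1.trans_le hy).false)
      measurableSet_Ioo hh.integrableOn hh.integrableOn, Iic_union_Ioo_eq_Iio hpq]
  unfold balPrim sideSelect between
  rcases lt_trichotomy x₀ t with hlt | rfl | hlt
  · rw [hIic, hIic, hIio hlt]
    simp only [hlt, if_true, Ioo_eq_empty (not_lt.2 hlt.le), union_empty]
    ring
  · simp
  · rw [hIic, hIic, hIio hlt]
    simp only [hlt, not_lt.2 hlt.le, if_true, if_false, Ioo_eq_empty (not_lt.2 hlt.le), empty_union]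
    ring

theorem exists_inv_bound (m : Measure ℝ) [IsFiniteMeasure m] {a b : ℝ → ℂ}
    (ha : Integrable a m) (hb : Integrable b m) {k : ℝ → ℂ} {L : ℝ} (hk : ∀ t, ‖k t‖ ≤ L) :
    ∃ K, ∀ t, ‖(1 - k t ^ 2 * (a t * m.real {t}) * (b t * m.real {t}))⁻¹‖ ≤ K := by
  set Mb := ∫ s, ‖b s‖ ∂m
  have hMb : 0 ≤ Mb := integral_nonneg fun _ => norm_nonneg _
  have hL : 0 ≤ L := (norm_nonneg _).trans (hk 0)
  set ε : ℝ := 1 / (2 * (L ^ 2 * Mb + 1)) with hε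
  have hfin := finite_large_atoms m ha (ε := ε) (by positivity)
  obtain ⟨K, hK⟩ := (hfin.image fun t =>
    ‖(1 - k t ^ 2 * (a t * m.real {t}) * (b t * m.real {t}))⁻¹‖).bddAbove
  refine ⟨max K 2, fun t => ?_⟩
  by_cases ht : ε ≤ ‖a t * m.real {t}‖
  · exact le_max_of_le_left (hK ⟨t, ht, rfl⟩)
  · refine le_max_of_le_right ?_
    have h1 : ‖k t ^ 2 * (a t * m.real {t}) * (b t * m.real {t})‖ ≤ 1 / 2 := by
      rw [norm_mul, norm_mul, norm_pow]
      calc ‖k t‖ ^ 2 * ‖a t * m.real {t}‖ * ‖b t * m.real {t}‖ ≤ L ^ 2 * ε * Mb := by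
            gcongr
            · exact hk t
            · exact (not_le.1 ht).le
            · exact norm_atom_le m hb t
        _ ≤ 1 / 2 := by
            rw [hε]
            rw [mul_one_div, div_mul_eq_mul_div, div_le_div_iff₀ (by positivity) (by norm_num)]
            nlinarith
    rw [norm_inv]
    have h2 : 1 / 2 ≤ ‖1 - k t ^ 2 * (a t * m.real {t}) * (b t * m.real {t})‖ := by
      have := norm_sub_norm_le (1 : ℂ) (k t ^ 2 * (a t * m.real {t}) * (b t * m.real {t}))
      rw [norm_one] at this
      linarith
    rw [inv_le_comm₀ (by linarith) (by norm_num)]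
    linarith

theorem exists_solve_bound (m : Measure ℝ) [IsFiniteMeasure m] {a b : ℝ → ℂ}
    (ha : Integrable a m) (hb : Integrable b m) {k : ℝ → ℂ} {L : ℝ} (hk : ∀ t, ‖k t‖ ≤ L)
    (hdet : ∀ t, 1 - k t ^ 2 * (a t * m.real {t}) * (b t * m.real {t}) ≠ 0) :
    ∃ K > 0, ∀ t, ∀ u w z₁ z₂ : ℂ, u = k t * (w * a t * m.real {t}) + z₁ →
      w = k t * (u * b t * m.real {t}) + z₂ →
      ‖u‖ ≤ K * (‖z₁‖ + ‖z₂‖) ∧ ‖w‖ ≤ K * (‖z₁‖ + ‖z₂‖) := by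
  obtain ⟨K, hK⟩ := exists_inv_bound m ha hb hk
  have hK0 : 0 ≤ K := (norm_nonneg _).trans (hK 0)
  have hL : 0 ≤ L := (norm_nonneg _).trans (hk 0)
  set Ma := ∫ s, ‖a s‖ ∂m
  set Mb := ∫ s, ‖b s‖ ∂m
  have hMa : 0 ≤ Ma := integral_nonneg fun _ => norm_nonneg _
  have hMb : 0 ≤ Mb := integral_nonneg fun _ => norm_nonneg _
  refine ⟨K * (1 + L * Ma + L * Mb) + 1, by positivity, fun t u w z₁ z₂ hu hw => ?_⟩
  set p := a t * m.real {t} with hp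
  set q := b t * m.real {t} with hq
  have hpM : ‖k t * p‖ ≤ L * Ma := by
    rw [norm_mul]
    exact mul_le_mul (hk t) (norm_atom_le m ha t) (norm_nonneg _) hL
  have hqM : ‖k t * q‖ ≤ L * Mb := by
    rw [norm_mul]
    exact mul_le_mul (hk t) (norm_atom_le m hb t) (norm_nonneg _) hL
  have hu' : u = (1 - k t ^ 2 * p * q)⁻¹ * (z₁ + k t * p * z₂) := by
    rw [eq_inv_mul_iff_mul_eq₀ (hdet t)]
    have : w * a t * m.real {t} = w * p := by rw [hp]; ring
    rw [this] at hu
    have : u * b t * m.real {t} = u * q := by rw [hq]; ring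
    rw [this] at hw
    linear_combination hu + k t * p * hw
  have hw' : w = (1 - k t ^ 2 * p * q)⁻¹ * (z₂ + k t * q * z₁) := by
    rw [eq_inv_mul_iff_mul_eq₀ (hdet t)]
    have : w * a t * m.real {t} = w * p := by rw [hp]; ring
    rw [this] at hu
    have : u * b t * m.real {t} = u * q := by rw [hq]; ring
    rw [this] at hw
    linear_combination hw + k t * q * hu
  have h1 := norm_nonneg z₁
  have h2 := norm_nonneg z₂
  have hLa : 0 ≤ L * Ma := by positivity
  have hLb : 0 ≤ L * Mb := by positivity
  constructor
  · calc ‖u‖ ≤ K * (‖z₁‖ + L * Ma * ‖z₂‖) := by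
          rw [hu', norm_mul]
          refine mul_le_mul (hK t) ?_ (norm_nonneg _) hK0
          refine (norm_add_le _ _).trans ?_
          rw [norm_mul _ z₂]
          gcongr
      _ ≤ K * ((1 + L * Ma + L * Mb) * (‖z₁‖ + ‖z₂‖)) := by
          gcongr
          nlinarith [mul_nonneg hLa h1, mul_nonneg hLb h1, mul_nonneg hLb h2]
      _ ≤ _ := by nlinarith
  · calc ‖w‖ ≤ K * (‖z₂‖ + L * Mb * ‖z₁‖) := by
          rw [hw', norm_mul]
          refine mul_le_mul (hK t) ?_ (norm_nonneg _) hK0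
          refine (norm_add_le _ _).trans ?_
          rw [norm_mul _ z₁]
          gcongr
      _ ≤ K * ((1 + L * Ma + L * Mb) * (‖z₁‖ + ‖z₂‖)) := by
          gcongr
          nlinarith [mul_nonneg hLa h1, mul_nonneg hLa h2, mul_nonneg hLb h2]
      _ ≤ _ := by nlinarith

theorem exists_contraction (m : Measure ℝ) [IsFiniteMeasure m] {a b : ℝ → ℂ}
    (ham : Measurable a) (hbm : Measurable b)
    (ha : Integrable a m) (hb : Integrable b m) {k σ : ℝ → ℂ} {L : ℝ} (hk : ∀ t, ‖k t‖ ≤ L)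
    (hσ : ∀ t, ‖σ t‖ ≤ 2) (x₀ : ℝ)
    (hdet : ∀ t, 1 - k t ^ 2 * (a t * m.real {t}) * (b t * m.real {t}) ≠ 0) :
    ∃ (ρ : ℝ → ℝ) (R : ℝ), (∀ t, 1 ≤ ρ t) ∧ (∀ t, ρ t ≤ R) ∧
      ∀ (C : ℝ) (t : ℝ) (u w : ℂ) (p q : ℝ → ℂ), 0 ≤ C →
        (∀ s ∈ between x₀ t, ‖p s‖ ≤ C * ρ s ∧ ‖q s‖ ≤ C * ρ s) →
        u = k t * (w * a t * m.real {t}) + σ t * ∫ s in between x₀ t, q s * a s ∂m →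
        w = k t * (u * b t * m.real {t}) + σ t * ∫ s in between x₀ t, p s * b s ∂m →
        ‖u‖ ≤ 1 / 2 * (C * ρ t) ∧ ‖w‖ ≤ 1 / 2 * (C * ρ t) := by
  obtain ⟨K, hK, hsolve⟩ := exists_solve_bound m ha hb hk hdet
  obtain ⟨ρ, R, hρm, hρ1, hρR, hρ⟩ := exists_weight m (f := fun s => ‖a s‖ + ‖b s‖)
    (fun s => by positivity) (ha.norm.add hb.norm) (ham.norm.add hbm.norm) x₀
    (K := 2 * K) (by positivity)
  have hint : ∀ {c : ℝ → ℂ}, Integrable c m → Integrable (fun s => ‖c s‖ * ρ s) m := by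
    intro c hc
    refine hc.norm.mul_bdd (c := R) hρm.aestronglyMeasurable (ae_of_all _ fun s => ?_)
    rw [Real.norm_of_nonneg (zero_le_one.trans (hρ1 s))]
    exact hρR s
  have hmeas : ∀ t, MeasurableSet (between x₀ t) := fun t =>
    measurableSet_Ioo.union measurableSet_Ioo
  refine ⟨ρ, R, hρ1, hρR, fun C t u w p q hC hpq hu hw => ?_⟩
  have key : ∀ {c p : ℝ → ℂ}, Integrable c m → (∀ s ∈ between x₀ t, ‖p s‖ ≤ C * ρ s) →
      ‖σ t * ∫ s in between x₀ t, p s * c s ∂m‖ ≤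
        2 * (C * ∫ s in between x₀ t, ‖c s‖ * ρ s ∂m) := by
    intro c p hc hp
    rw [norm_mul]
    refine mul_le_mul (hσ t) ?_ (norm_nonneg _) zero_le_two
    rw [← integral_const_mul]
    refine norm_integral_le_of_norm_le ((hint hc).const_mul C).integrableOn ?_
    refine (ae_restrict_iff' (hmeas t)).2 (ae_of_all _ fun s hs => ?_)
    rw [norm_mul]
    calc ‖p s‖ * ‖c s‖ ≤ C * ρ s * ‖c s‖ := by gcongr; exact hp s hs
      _ = _ := by ring
  have h1 := key ha fun s hs => (hpq s hs).2
  have h2 := key hb fun s hs => (hpq s hs).1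
  have h3 : (∫ s in between x₀ t, ‖a s‖ * ρ s ∂m) + (∫ s in between x₀ t, ‖b s‖ * ρ s ∂m) =
      ∫ s in between x₀ t, (‖a s‖ + ‖b s‖) * ρ s ∂m := by
    rw [← integral_add (hint ha).integrableOn (hint hb).integrableOn]
    simp only [add_mul]
  have h4 := hρ t
  rw [← h3] at h4
  have h5 : K * (‖σ t * ∫ s in between x₀ t, q s * a s ∂m‖ +
      ‖σ t * ∫ s in between x₀ t, p s * b s ∂m‖) ≤ 1 / 2 * (C * ρ t) := by
    calc _ ≤ K * (2 * (C * ∫ s in between x₀ t, ‖a s‖ * ρ s ∂m) +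
          2 * (C * ∫ s in between x₀ t, ‖b s‖ * ρ s ∂m)) := by gcongr
      _ = C * (2 * K * ((∫ s in between x₀ t, ‖a s‖ * ρ s ∂m) +
          ∫ s in between x₀ t, ‖b s‖ * ρ s ∂m)) := by ring
      _ ≤ C * (1 / 2 * ρ t) := by gcongr
      _ = _ := by ring
  obtain ⟨h6, h7⟩ := hsolve t u w _ _ hu hw
  exact ⟨h6.trans h5, h7.trans h5⟩

theorem measurable_measureReal_singleton (m : Measure ℝ) [IsFiniteMeasure m] :
    Measurable fun t => m.real {t} := by
  have := measurable_measure_prodMk_left (ν := m) (measurableSet_diagonal (α := ℝ))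
  refine Measurable.ennreal_toReal ?_
  convert this using 3
  ext s
  simp [eq_comm]

theorem stronglyMeasurable_setIntegral_between (m : Measure ℝ) [IsFiniteMeasure m] (x₀ : ℝ)
    {h : ℝ → ℂ} (hh : Measurable h) :
    StronglyMeasurable fun t => ∫ s in between x₀ t, h s ∂m := by
  set S : Set (ℝ × ℝ) := {p | x₀ < p.2 ∧ p.2 < p.1} ∪ {p | p.1 < p.2 ∧ p.2 < x₀}
  have hS : MeasurableSet S :=
    ((measurableSet_lt measurable_const measurable_snd).inter
      (measurableSet_lt measurable_snd measurable_fst)).union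
    ((measurableSet_lt measurable_fst measurable_snd).inter
      (measurableSet_lt measurable_snd measurable_const))
  have := ((hh.comp measurable_snd).indicator hS).stronglyMeasurable.integral_prod_right'
    (ν := m)
  convert this using 2 with t
  exact (integral_indicator (measurableSet_Ioo.union measurableSet_Ioo)).symm

theorem sideSelect_self (x₀ : ℝ) (p q : ℂ) : sideSelect x₀ p q x₀ = 0 := by
  simp [sideSelect]

theorem det_sideSelect_ne_zero {m : Measure ℝ} {a b : ℝ → ℂ} {r : ℂ} (x₀ : ℝ)
    (hdet : ∀ t, 1 - (1 - r) ^ 2 * (a t * m.real {t}) * (b t * m.real {t}) ≠ 0 ∧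
      1 - r ^ 2 * (a t * m.real {t}) * (b t * m.real {t}) ≠ 0) (t : ℝ) :
    1 - sideSelect x₀ (1 - r) (-r) t ^ 2 * (a t * m.real {t}) * (b t * m.real {t}) ≠ 0 := by
  unfold sideSelect
  split_ifs
  · exact (hdet t).1
  · simpa using (hdet t).2
  · simp

theorem exists_integral_solution (m : Measure ℝ) [IsFiniteMeasure m] {a b e : ℝ → ℂ}
    (ham : Measurable a) (hbm : Measurable b) (hem : Measurable e)
    (ha : Integrable a m) (hb : Integrable b m) (he : Integrable e m) (r : ℂ) (x₀ : ℝ)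
    (hdet : ∀ t, 1 - (1 - r) ^ 2 * (a t * m.real {t}) * (b t * m.real {t}) ≠ 0 ∧
      1 - r ^ 2 * (a t * m.real {t}) * (b t * m.real {t}) ≠ 0) (A B : ℂ) :
    ∃ u w : ℝ → ℂ, BddMeas u ∧ BddMeas w ∧
      (∀ t, u t = A + (balPrim m r (fun s => w s * a s) t -
        balPrim m r (fun s => w s * a s) x₀)) ∧
      ∀ t, w t = B + (balPrim m r (fun s => u s * b s - e s) t -
        balPrim m r (fun s => u s * b s - e s) x₀) := by
  set k := sideSelect x₀ (1 - r) (-r) with hkdef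
  set l := sideSelect x₀ r (-(1 - r)) with hldef
  set σ := sideSelect x₀ 1 (-1) with hσdef
  have hkm : Measurable k := measurable_sideSelect _ _ _
  have hlm : Measurable l := measurable_sideSelect _ _ _
  have hσm : Measurable σ := measurable_sideSelect _ _ _
  have hk := norm_sideSelect_le x₀ (1 - r) (-r)
  have hl := norm_sideSelect_le x₀ r (-(1 - r))
  have hσ : ∀ t, ‖σ t‖ ≤ 2 := fun t => (norm_sideSelect_le x₀ 1 (-1) t).trans (by norm_num)
  have hD := det_sideSelect_ne_zero x₀ hdet
  obtain ⟨ρ, R, hρ1, hρR, hcontr⟩ := exists_contraction m ham hbm ha hb hk hσ x₀ hD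
  obtain ⟨K, hK, hsolve⟩ := exists_solve_bound m ha hb hk hD
  have hatom : Measurable fun t => (m.real {t} : ℂ) :=
    Complex.measurable_ofReal.comp (measurable_measureReal_singleton m)
  have hinta : ∀ {w : ℝ → ℂ}, BddMeas w → ∀ {c : ℝ → ℂ}, Integrable c m →
      Integrable (fun s => w s * c s) m := by
    rintro w ⟨hw, C, hC⟩ c hc
    exact hc.bdd_mul hw.aestronglyMeasurable (ae_of_all _ hC)
  set z₁ : (ℝ → ℂ × ℂ) → ℝ → ℂ := fun y t =>
    A + l t * (B * a x₀ * m.real {x₀}) + σ t * ∫ s in between x₀ t, (y s).2 * a s ∂m with hz₁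
  set z₂ : (ℝ → ℂ × ℂ) → ℝ → ℂ := fun y t =>
    B + k t * (-e t * m.real {t}) + l t * ((A * b x₀ - e x₀) * m.real {x₀}) +
      σ t * ∫ s in between x₀ t, ((y s).1 * b s - e s) ∂m with hz₂
  set D : ℝ → ℂ := fun t => 1 - k t ^ 2 * (a t * m.real {t}) * (b t * m.real {t}) with hDdef
  set Φ : (ℝ → ℂ × ℂ) → ℝ → ℂ × ℂ := fun y t =>
    ((D t)⁻¹ * (z₁ y t + k t * (a t * m.real {t}) * z₂ y t),
      (D t)⁻¹ * (z₂ y t + k t * (b t * m.real {t}) * z₁ y t)) with hΦ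
  have hΦ1 : ∀ y t, (Φ y t).1 = k t * ((Φ y t).2 * a t * m.real {t}) + z₁ y t := by
    intro y t
    have := mul_inv_cancel₀ (hD t)
    change D t * (D t)⁻¹ = 1 at this
    simp only [hΦ]
    simp only [hDdef] at this ⊢
    linear_combination (z₁ y t) * this
  have hΦ2 : ∀ y t, (Φ y t).2 = k t * ((Φ y t).1 * b t * m.real {t}) + z₂ y t := by
    intro y t
    have := mul_inv_cancel₀ (hD t)
    change D t * (D t)⁻¹ = 1 at this
    simp only [hΦ]
    simp only [hDdef] at this ⊢
    linear_combination (z₂ y t) * this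
  have hfst : ∀ {y : ℝ → ℂ × ℂ}, BddMeas y → BddMeas fun s => (y s).1 := by
    rintro y ⟨hy, C, hC⟩
    exact ⟨hy.fst, C, fun t => (norm_fst_le _).trans (hC t)⟩
  have hsnd : ∀ {y : ℝ → ℂ × ℂ}, BddMeas y → BddMeas fun s => (y s).2 := by
    rintro y ⟨hy, C, hC⟩
    exact ⟨hy.snd, C, fun t => (norm_snd_le _).trans (hC t)⟩
  have hinte : ∀ {y : ℝ → ℂ × ℂ}, BddMeas y → Integrable (fun s => (y s).1 * b s - e s) m :=
    fun hy => (hinta (hfst hy) hb).sub he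
  have hbddint : ∀ {h : ℝ → ℂ}, Integrable h m → ∀ t,
      ‖σ t * ∫ s in between x₀ t, h s ∂m‖ ≤ 2 * ∫ s, ‖h s‖ ∂m := by
    intro h hh t
    rw [norm_mul]
    refine mul_le_mul (hσ t) ?_ (norm_nonneg _) zero_le_two
    exact (norm_integral_le_integral_norm _).trans
      (setIntegral_le_integral hh.norm (ae_of_all _ fun _ => norm_nonneg _))
  have hL0 : 0 ≤ ‖1 - r‖ + ‖-r‖ := by positivity
  have hL1 : 0 ≤ ‖r‖ + ‖-(1 - r)‖ := by positivity
  obtain ⟨y, hy, hfix⟩ := exists_fixedPoint_of_weight (Φ := Φ) hρ1 hρR (by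
    intro y hy
    have h1 := hinta (hsnd hy) ha
    have h2 := hinte hy
    refine ⟨?_, ?_⟩
    · have hI1 := stronglyMeasurable_setIntegral_between m x₀
        (h := fun s => (y s).2 * a s) ((hsnd hy).1.measurable.mul ham)
      have hI2 := stronglyMeasurable_setIntegral_between m x₀
        (h := fun s => (y s).1 * b s - e s) (((hfst hy).1.measurable.mul hbm).sub hem)
      have hm1 : Measurable (z₁ y) :=
        (measurable_const.add (hlm.mul measurable_const)).add (hσm.mul hI1.measurable)
      have hm2 : Measurable (z₂ y) :=
        ((measurable_const.add (hkm.mul (hem.neg.mul hatom))).add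
          (hlm.mul measurable_const)).add (hσm.mul hI2.measurable)
      have hDm : Measurable D :=
        measurable_const.sub (((hkm.pow_const 2).mul (ham.mul hatom)).mul (hbm.mul hatom))
      exact ((hDm.inv.mul (hm1.add ((hkm.mul (ham.mul hatom)).mul hm2))).prodMk
        (hDm.inv.mul (hm2.add ((hkm.mul (hbm.mul hatom)).mul hm1)))).stronglyMeasurable
    · have hC1 : ∃ C₁, ∀ t, ‖z₁ y t‖ ≤ C₁ := by
        refine ⟨‖A‖ + (‖r‖ + ‖-(1 - r)‖) * ‖B * a x₀ * m.real {x₀}‖ +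
          2 * ∫ s, ‖(y s).2 * a s‖ ∂m, fun t => ?_⟩
        refine (norm_add_le _ _).trans (add_le_add ((norm_add_le _ _).trans
          (add_le_add le_rfl ?_)) (hbddint h1 t))
        rw [norm_mul]
        exact mul_le_mul_of_nonneg_right (hl t) (norm_nonneg _)
      have hC2 : ∃ C₂, ∀ t, ‖z₂ y t‖ ≤ C₂ := by
        refine ⟨‖B‖ + (‖1 - r‖ + ‖-r‖) * (∫ s, ‖-e s‖ ∂m) +
          (‖r‖ + ‖-(1 - r)‖) * ‖(A * b x₀ - e x₀) * m.real {x₀}‖ +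
          2 * ∫ s, ‖(y s).1 * b s - e s‖ ∂m, fun t => ?_⟩
        refine (norm_add_le _ _).trans (add_le_add ((norm_add_le _ _).trans
          (add_le_add ((norm_add_le _ _).trans (add_le_add le_rfl ?_)) ?_)) (hbddint h2 t))
        · rw [norm_mul]
          exact mul_le_mul (hk t) (norm_atom_le m he.neg t) (norm_nonneg _) hL0
        · rw [norm_mul]
          exact mul_le_mul_of_nonneg_right (hl t) (norm_nonneg _)
      obtain ⟨C₁, hC₁⟩ := hC1
      obtain ⟨C₂, hC₂⟩ := hC2
      refine ⟨K * (C₁ + C₂), fun t => ?_⟩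
      obtain ⟨h3, h4⟩ := hsolve t _ _ _ _ (hΦ1 y t) (hΦ2 y t)
      have h5 : K * (‖z₁ y t‖ + ‖z₂ y t‖) ≤ K * (C₁ + C₂) := by
        gcongr
        · exact hC₁ t
        · exact hC₂ t
      exact max_le (h3.trans h5) (h4.trans h5)) (by
    intro y y' C hy hy' hyy t
    have hC : 0 ≤ C := by
      by_contra! hC
      have := (norm_nonneg _).trans (hyy x₀)
      nlinarith [hρ1 x₀]
    have h1 := hcontr C t ((Φ y t).1 - (Φ y' t).1) ((Φ y t).2 - (Φ y' t).2)
      (fun s => (y s).1 - (y' s).1) (fun s => (y s).2 - (y' s).2) hC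
      (fun s _ => ⟨(norm_fst_le (y s - y' s)).trans (hyy s),
        (norm_snd_le (y s - y' s)).trans (hyy s)⟩) ?_ ?_
    · exact max_le h1.1 h1.2
    · have h2 : ∫ s in between x₀ t, ((y s).2 - (y' s).2) * a s ∂m =
          (∫ s in between x₀ t, (y s).2 * a s ∂m) - ∫ s in between x₀ t, (y' s).2 * a s ∂m := by
        rw [← integral_sub (hinta (hsnd hy) ha).integrableOn (hinta (hsnd hy') ha).integrableOn]
        simp only [sub_mul]
      rw [h2]
      have h3 := hΦ1 y t
      have h4 := hΦ1 y' t
      simp only [hz₁] at h3 h4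
      linear_combination h3 - h4
    · have h2 : ∫ s in between x₀ t, ((y s).1 - (y' s).1) * b s ∂m =
          (∫ s in between x₀ t, ((y s).1 * b s - e s) ∂m) -
            ∫ s in between x₀ t, ((y' s).1 * b s - e s) ∂m := by
        rw [← integral_sub (hinte hy).integrableOn (hinte hy').integrableOn]
        congr 1
        ext s
        ring
      rw [h2]
      have h3 := hΦ2 y t
      have h4 := hΦ2 y' t
      simp only [hz₂] at h3 h4
      linear_combination h3 - h4)
  have hb0 : between x₀ x₀ = ∅ := by simp [between]
  have hu0 : (y x₀).1 = A := by
    have := hΦ1 y x₀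
    rw [hfix] at this
    simpa [hz₁, hkdef, hldef, hσdef, sideSelect_self] using this
  have hw0 : (y x₀).2 = B := by
    have := hΦ2 y x₀
    rw [hfix] at this
    simpa [hz₂, hkdef, hldef, hσdef, sideSelect_self] using this
  refine ⟨fun s => (y s).1, fun s => (y s).2, hfst hy, hsnd hy, fun t => ?_, fun t => ?_⟩
  · rw [balPrim_sub m r (hinta (hsnd hy) ha) x₀ t, hw0]
    have := hΦ1 y t
    rw [hfix] at this
    simp only [hz₁] at this
    linear_combination this
  · rw [balPrim_sub m r (hinte hy) x₀ t, hu0]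
    have := hΦ2 y t
    rw [hfix] at this
    simp only [hz₂] at this
    linear_combination this

theorem integral_solution_unique (m : Measure ℝ) [IsFiniteMeasure m] {a b e : ℝ → ℂ}
    (ham : Measurable a) (hbm : Measurable b)
    (ha : Integrable a m) (hb : Integrable b m) (r : ℂ) (x₀ : ℝ)
    (hdet : ∀ t, 1 - (1 - r) ^ 2 * (a t * m.real {t}) * (b t * m.real {t}) ≠ 0 ∧
      1 - r ^ 2 * (a t * m.real {t}) * (b t * m.real {t}) ≠ 0) {A B : ℂ}
    {S : Set ℝ} (hx₀ : x₀ ∈ S) (hS : ∀ t ∈ S, between x₀ t ⊆ S)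
    {u w u' w' : ℝ → ℂ} {C : ℝ}
    (hC : ∀ t ∈ S, ‖u t‖ ≤ C ∧ ‖w t‖ ≤ C ∧ ‖u' t‖ ≤ C ∧ ‖w' t‖ ≤ C)
    (hwa : Integrable (fun s => w s * a s) m) (hub : Integrable (fun s => u s * b s - e s) m)
    (hwa' : Integrable (fun s => w' s * a s) m) (hub' : Integrable (fun s => u' s * b s - e s) m)
    (hu : ∀ t ∈ S, u t = A + (balPrim m r (fun s => w s * a s) t -
        balPrim m r (fun s => w s * a s) x₀))
    (hw : ∀ t ∈ S, w t = B + (balPrim m r (fun s => u s * b s - e s) t -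
        balPrim m r (fun s => u s * b s - e s) x₀))
    (hu' : ∀ t ∈ S, u' t = A + (balPrim m r (fun s => w' s * a s) t -
        balPrim m r (fun s => w' s * a s) x₀))
    (hw' : ∀ t ∈ S, w' t = B + (balPrim m r (fun s => u' s * b s - e s) t -
        balPrim m r (fun s => u' s * b s - e s) x₀)) :
    ∀ t ∈ S, u t = u' t ∧ w t = w' t := by
  have hk := norm_sideSelect_le x₀ (1 - r) (-r)
  have hσ : ∀ t, ‖sideSelect x₀ 1 (-1) t‖ ≤ 2 := fun t =>
    (norm_sideSelect_le x₀ 1 (-1) t).trans (by norm_num)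
  have hD := det_sideSelect_ne_zero x₀ hdet
  obtain ⟨ρ, R, hρ1, hρR, hcontr⟩ := exists_contraction m ham hbm ha hb hk hσ x₀ hD
  have hC0 : 0 ≤ C := (norm_nonneg _).trans (hC x₀ hx₀).1
  have huu0 : u x₀ = u' x₀ := by rw [hu _ hx₀, hu' _ hx₀]; simp
  have hww0 : w x₀ = w' x₀ := by rw [hw _ hx₀, hw' _ hx₀]; simp
  have key : ∀ n : ℕ, ∀ t ∈ S, ‖u t - u' t‖ ≤ 2 * C * (1 / 2) ^ n * ρ t ∧
      ‖w t - w' t‖ ≤ 2 * C * (1 / 2) ^ n * ρ t := by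
    intro n
    induction n with
    | zero =>
      intro t ht
      obtain ⟨h1, h2, h3, h4⟩ := hC t ht
      have h5 : 2 * C ≤ 2 * C * (1 / 2) ^ 0 * ρ t := by nlinarith [hρ1 t]
      exact ⟨(norm_sub_le _ _).trans (by linarith), (norm_sub_le _ _).trans (by linarith)⟩
    | succ n ih =>
      intro t ht
      have h1 := hcontr (2 * C * (1 / 2) ^ n) t (u t - u' t) (w t - w' t)
        (fun s => u s - u' s) (fun s => w s - w' s) (by positivity)
        (fun s hs => ih s (hS t ht hs)) ?_ ?_
      · refine ⟨h1.1.trans_eq ?_, h1.2.trans_eq ?_⟩ <;> ring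
      · have h2 : ∫ s in between x₀ t, (w s - w' s) * a s ∂m =
            (∫ s in between x₀ t, w s * a s ∂m) - ∫ s in between x₀ t, w' s * a s ∂m := by
          rw [← integral_sub hwa.integrableOn hwa'.integrableOn]
          simp only [sub_mul]
        have h3 := hu t ht
        have h4 := hu' t ht
        rw [balPrim_sub m r hwa x₀ t] at h3
        rw [balPrim_sub m r hwa' x₀ t, ← hww0] at h4
        rw [h2]
        linear_combination h3 - h4
      · have h2 : ∫ s in between x₀ t, (u s - u' s) * b s ∂m =
            (∫ s in between x₀ t, (u s * b s - e s) ∂m) -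
              ∫ s in between x₀ t, (u' s * b s - e s) ∂m := by
          rw [← integral_sub hub.integrableOn hub'.integrableOn]
          congr 1
          ext s
          ring
        have h3 := hw t ht
        have h4 := hw' t ht
        rw [balPrim_sub m r hub x₀ t] at h3
        rw [balPrim_sub m r hub' x₀ t, ← huu0] at h4
        rw [h2]
        linear_combination h3 - h4
  intro t ht
  have hlim : Tendsto (fun n : ℕ => 2 * C * (1 / 2) ^ n * ρ t) atTop (𝓝 0) := by
    have := ((tendsto_pow_atTop_nhds_zero_of_lt_one (r := (1 / 2 : ℝ)) (by norm_num)
      (by norm_num)).const_mul (2 * C)).mul_const (ρ t)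
    simpa using this
  have h1 : ‖u t - u' t‖ ≤ 0 := ge_of_tendsto' hlim fun n => (key n t ht).1
  have h2 : ‖w t - w' t‖ ≤ 0 := ge_of_tendsto' hlim fun n => (key n t ht).2
  exact ⟨sub_eq_zero.1 (norm_le_zero_iff.1 h1), sub_eq_zero.1 (norm_le_zero_iff.1 h2)⟩

theorem rightLim_eq_of_eventuallyEq {E : Type*} [TopologicalSpace E] [T2Space E] {f g : ℝ → E}
    {x : ℝ} {l : E} (h : f =ᶠ[𝓝 x] g) (hf : Tendsto f (𝓝[>] x) (𝓝 l)) : rightLim g x = l :=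
  rightLim_eq_of_tendsto (hf.congr' (h.filter_mono nhdsWithin_le_nhds))

theorem leftLim_eq_of_eventuallyEq {E : Type*} [TopologicalSpace E] [T2Space E] {f g : ℝ → E}
    {x : ℝ} {l : E} (h : f =ᶠ[𝓝 x] g) (hf : Tendsto f (𝓝[<] x) (𝓝 l)) : leftLim g x = l :=
  leftLim_eq_of_tendsto (hf.congr' (h.filter_mono nhdsWithin_le_nhds))

theorem exists_clamp {E : Type*} [NormedAddCommGroup E] {I : Set ℝ}
    (hI : IsOpen I) (hI' : I.OrdConnected) {f : ℝ → E} (hf : LocallyBoundedVariationOn f I)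
    {c d : ℝ} (hc : c ∈ I) (hd : d ∈ I) :
    ∃ g : ℝ → E, BoundedVariationOn g univ ∧ ∀ x ∈ Icc c d, f =ᶠ[𝓝 x] g := by
  obtain ⟨c', c'', hc1, hc2⟩ := mem_nhds_iff_exists_Ioo_subset.1 (hI.mem_nhds hc)
  obtain ⟨d'', d', hd1, hd2⟩ := mem_nhds_iff_exists_Ioo_subset.1 (hI.mem_nhds hd)
  obtain ⟨p, hp1, hp2⟩ := exists_between hc1.1
  obtain ⟨q, hq1, hq2⟩ := exists_between hd1.2
  have hpI : p ∈ I := hc2 ⟨hp1, hp2.trans hc1.2⟩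
  have hqI : q ∈ I := hd2 ⟨hd1.1.trans hq1, hq2⟩
  by_cases hpq : p ≤ q
  · refine ⟨f ∘ fun x => max p (min q x), ?_, fun x hx => ?_⟩
    · refine ne_top_of_le_ne_top (hf p q hpI hqI) (eVariationOn.comp_le_of_monotoneOn f _ ?_ ?_)
      · exact fun x _ y _ hxy => max_le_max le_rfl (min_le_min le_rfl hxy)
      · intro x _
        have h1 : max p (min q x) ∈ Icc p q := ⟨le_max_left _ _, max_le hpq (min_le_left _ _)⟩
        exact ⟨hI'.out hpI hqI h1, h1⟩
    · filter_upwards [Ioo_mem_nhds (hp2.trans_le hx.1) (hx.2.trans_lt hq1)] with y hy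
      simp [max_eq_right hy.1.le, min_eq_right hy.2.le]
  · refine ⟨fun _ => f c, ?_, fun x hx => ?_⟩
    · exact ne_top_of_le_ne_top ENNReal.zero_ne_top (eVariationOn.constant_on
        (by rintro _ ⟨x, -, rfl⟩ _ ⟨y, -, rfl⟩; rfl)).le
    · exact absurd (hp2.le.trans ((hx.1.trans hx.2).trans hq1.le)) hpq

theorem LocallyBoundedVariationOn.tendsto_lims {E : Type*} [NormedAddCommGroup E] [CompleteSpace E]
    {I : Set ℝ} (hI : IsOpen I) (hI' : I.OrdConnected) {f : ℝ → E}
    (hf : LocallyBoundedVariationOn f I) {x : ℝ} (hx : x ∈ I) :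
    Tendsto f (𝓝[>] x) (𝓝 (rightLim f x)) ∧ Tendsto f (𝓝[<] x) (𝓝 (leftLim f x)) := by
  obtain ⟨g, hg, hfg⟩ := exists_clamp hI hI' hf hx hx
  have h := (hfg x (by simp)).symm
  have h1 := hg.tendsto_rightLim x
  have h2 := hg.tendsto_leftLim x
  rw [← rightLim_eq_of_eventuallyEq h h1] at h1
  rw [← leftLim_eq_of_eventuallyEq h h2] at h2
  exact ⟨h1.congr' (h.filter_mono nhdsWithin_le_nhds), h2.congr' (h.filter_mono nhdsWithin_le_nhds)⟩

theorem BoundedVariationOn.measurable_real {g : ℝ → ℝ} (hg : BoundedVariationOn g univ) :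
    Measurable g := by
  obtain ⟨p, q, hp, hq, rfl⟩ := hg.locallyBoundedVariationOn.exists_monotoneOn_sub_monotoneOn
  exact (monotoneOn_univ.1 hp).measurable.sub (monotoneOn_univ.1 hq).measurable

theorem lipschitzWith_re : LipschitzWith 1 Complex.re :=
  LipschitzWith.of_dist_le_mul fun z w => by
    simpa [Complex.dist_eq, Real.dist_eq] using Complex.abs_re_le_norm (z - w)

theorem lipschitzWith_im : LipschitzWith 1 Complex.im :=
  LipschitzWith.of_dist_le_mul fun z w => by
    simpa [Complex.dist_eq, Real.dist_eq] using Complex.abs_im_le_norm (z - w)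

theorem BoundedVariationOn.bddMeas {g : ℝ → ℂ} (hg : BoundedVariationOn g univ) : BddMeas g := by
  have h1 : Measurable fun x => (g x).re :=
    BoundedVariationOn.measurable_real (lipschitzWith_re.comp_boundedVariationOn hg)
  have h2 : Measurable fun x => (g x).im :=
    BoundedVariationOn.measurable_real (lipschitzWith_im.comp_boundedVariationOn hg)
  refine ⟨?_, ‖g 0‖ + (eVariationOn g univ).toReal, fun t => ?_⟩
  · have : g = fun x => ((g x).re : ℂ) + (g x).im * Complex.I := by
      ext x
      exact (Complex.re_add_im _).symm
    rw [this]
    exact ((Complex.measurable_ofReal.comp h1).add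
      ((Complex.measurable_ofReal.comp h2).mul_const _)).stronglyMeasurable
  · have := hg.dist_le (mem_univ t) (mem_univ 0)
    rw [dist_eq_norm] at this
    have h3 := norm_le_norm_add_norm_sub' (g t) (g 0)
    linarith

/-- `h` is the density with respect to `m` of the Lebesgue–Stieltjes measure of `f` on `(c,d]`. -/
def HasDensity {E : Type*} [NormedAddCommGroup E] [NormedSpace ℝ E] (m : Measure ℝ) (f h : ℝ → E)
    (c d : ℝ) : Prop :=
  ∀ x ∈ Icc c d, ∀ y ∈ Icc c d, x ≤ y → rightLim f y - rightLim f x = ∫ s in Ioc x y, h s ∂m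

theorem signedMeasure_eq_sub (ν : SignedMeasure ℝ) {E : Set ℝ} (hE : MeasurableSet E) :
    ν E = ν.toJordanDecomposition.posPart.real E - ν.toJordanDecomposition.negPart.real E := by
  conv_lhs => rw [← SignedMeasure.toSignedMeasure_toJordanDecomposition ν]
  rw [JordanDecomposition.toSignedMeasure, _root_.sub_apply,
    Measure.toSignedMeasure_apply_measurable hE, Measure.toSignedMeasure_apply_measurable hE]

theorem exists_dominating_real {g : ℝ → ℝ} (hg : BoundedVariationOn g univ) :
    ∃ μ : Measure ℝ, IsFiniteMeasure μ ∧ ∀ M : Measure ℝ, IsFiniteMeasure M → μ ≤ M →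
      ∃ b : ℝ → ℝ, Measurable b ∧ Integrable b M ∧
        ∀ x y, x ≤ y → rightLim g y - rightLim g x = ∫ s in Ioc x y, b s ∂M := by
  set J := SignedMeasure.toJordanDecomposition hg.vectorMeasure with hJ
  refine ⟨J.posPart + J.negPart, inferInstance, fun M hM hle => ?_⟩
  have h1 : J.posPart ≪ M := (Measure.le_add_right le_rfl |>.trans hle).absolutelyContinuous
  have h2 : J.negPart ≪ M := (Measure.le_add_left le_rfl |>.trans hle).absolutelyContinuous
  have hi1 : Integrable (fun s => (J.posPart.rnDeriv M s).toReal) M :=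
    Measure.integrable_toReal_rnDeriv
  have hi2 : Integrable (fun s => (J.negPart.rnDeriv M s).toReal) M :=
    Measure.integrable_toReal_rnDeriv
  refine ⟨fun s => (J.posPart.rnDeriv M s).toReal - (J.negPart.rnDeriv M s).toReal, ?_,
    hi1.sub hi2, fun x y hxy => ?_⟩
  · exact (Measure.measurable_rnDeriv _ _).ennreal_toReal.sub
      (Measure.measurable_rnDeriv _ _).ennreal_toReal
  · rw [integral_sub hi1.integrableOn hi2.integrableOn, Measure.setIntegral_toReal_rnDeriv h1,
      Measure.setIntegral_toReal_rnDeriv h2, ← hg.vectorMeasure_Ioc hxy]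
    exact signedMeasure_eq_sub _ measurableSet_Ioc

theorem rightLim_re_im {g : ℝ → ℂ} {x : ℝ} (h : Tendsto g (𝓝[>] x) (𝓝 (rightLim g x))) :
    rightLim (fun s => (g s).re) x = (rightLim g x).re ∧
      rightLim (fun s => (g s).im) x = (rightLim g x).im :=
  ⟨rightLim_eq_of_tendsto ((Complex.continuous_re.tendsto _).comp h),
    rightLim_eq_of_tendsto ((Complex.continuous_im.tendsto _).comp h)⟩

theorem integral_re_im {m : Measure ℝ} {f : ℝ → ℂ} (hf : Integrable f m) :
    ∫ s, f s ∂m = ((∫ s, (f s).re ∂m : ℝ) : ℂ) + ((∫ s, (f s).im ∂m : ℝ) : ℂ) * Complex.I := by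
  have h1 := integral_re hf
  have h2 := integral_im hf
  simp only [RCLike.re_eq_complex_re, RCLike.im_eq_complex_im] at h1 h2
  rw [h1, h2, Complex.re_add_im]

theorem exists_dominating {g : ℝ → ℂ} (hg : BoundedVariationOn g univ) :
    ∃ μ : Measure ℝ, IsFiniteMeasure μ ∧ ∀ M : Measure ℝ, IsFiniteMeasure M → μ ≤ M →
      ∃ b : ℝ → ℂ, Measurable b ∧ Integrable b M ∧
        ∀ x y, x ≤ y → rightLim g y - rightLim g x = ∫ s in Ioc x y, b s ∂M := by
  obtain ⟨μ₁, hμ₁, h1⟩ :=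
    exists_dominating_real (lipschitzWith_re.comp_boundedVariationOn hg)
  obtain ⟨μ₂, hμ₂, h2⟩ :=
    exists_dominating_real (lipschitzWith_im.comp_boundedVariationOn hg)
  refine ⟨μ₁ + μ₂, inferInstance, fun M hM hle => ?_⟩
  obtain ⟨b₁, hb₁, hi₁, hr₁⟩ := h1 M hM ((Measure.le_add_right le_rfl).trans hle)
  obtain ⟨b₂, hb₂, hi₂, hr₂⟩ := h2 M hM ((Measure.le_add_left le_rfl).trans hle)
  have hi : Integrable (fun s => (b₁ s : ℂ) + b₂ s * Complex.I) M :=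
    hi₁.ofReal.add (hi₂.ofReal.mul_const _)
  refine ⟨fun s => (b₁ s : ℂ) + b₂ s * Complex.I,
    (Complex.measurable_ofReal.comp hb₁).add ((Complex.measurable_ofReal.comp hb₂).mul_const _),
    hi, fun x y hxy => ?_⟩
  have e1 := hr₁ x y hxy
  have e2 := hr₂ x y hxy
  have l1 := rightLim_re_im (hg.tendsto_rightLim x)
  have l2 := rightLim_re_im (hg.tendsto_rightLim y)
  simp only [comp_def] at e1 e2
  rw [l1.1, l2.1] at e1
  rw [l1.2, l2.2] at e2
  rw [integral_re_im hi.integrableOn]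
  apply Complex.ext <;> simp [← e1, ← e2]

theorem exists_densities {I : Set ℝ} (hI : IsOpen I) (hI' : I.OrdConnected) {α β η : ℝ → ℂ}
    (hα : LocallyBoundedVariationOn α I) (hβ : LocallyBoundedVariationOn β I)
    (hη : LocallyBoundedVariationOn η I) {c d : ℝ} (hc : c ∈ I) (hd : d ∈ I) :
    ∃ m : Measure ℝ, IsFiniteMeasure m ∧ m (Ioc c d)ᶜ = 0 ∧ ∃ a b e : ℝ → ℂ,
      Measurable a ∧ Measurable b ∧ Measurable e ∧
      Integrable a m ∧ Integrable b m ∧ Integrable e m ∧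
      HasDensity m α a c d ∧ HasDensity m β b c d ∧ HasDensity m η e c d := by
  obtain ⟨α', hα', hαe⟩ := exists_clamp hI hI' hα hc hd
  obtain ⟨β', hβ', hβe⟩ := exists_clamp hI hI' hβ hc hd
  obtain ⟨η', hη', hηe⟩ := exists_clamp hI hI' hη hc hd
  obtain ⟨μ₁, hμ₁, h1⟩ := exists_dominating hα'
  obtain ⟨μ₂, hμ₂, h2⟩ := exists_dominating hβ'
  obtain ⟨μ₃, hμ₃, h3⟩ := exists_dominating hη'
  obtain ⟨a, ham, ha, hra⟩ := h1 (μ₁ + μ₂ + μ₃) inferInstance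
    (Measure.le_add_right (Measure.le_add_right le_rfl))
  obtain ⟨b, hbm, hb, hrb⟩ := h2 (μ₁ + μ₂ + μ₃) inferInstance
    (Measure.le_add_right (Measure.le_add_left le_rfl))
  obtain ⟨e, hem, he, hre⟩ := h3 (μ₁ + μ₂ + μ₃) inferInstance (Measure.le_add_left le_rfl)
  have key : ∀ {f f' h : ℝ → ℂ}, BoundedVariationOn f' univ → (∀ x ∈ Icc c d, f =ᶠ[𝓝 x] f') →
      (∀ x y, x ≤ y → rightLim f' y - rightLim f' x = ∫ s in Ioc x y, h s ∂(μ₁ + μ₂ + μ₃)) →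
      HasDensity ((μ₁ + μ₂ + μ₃).restrict (Ioc c d)) f h c d := by
    intro f f' h hf' hff hr x hx y hy hxy
    rw [rightLim_eq_of_eventuallyEq (hff x hx).symm (hf'.tendsto_rightLim x),
      rightLim_eq_of_eventuallyEq (hff y hy).symm (hf'.tendsto_rightLim y), hr x y hxy,
      Measure.restrict_restrict measurableSet_Ioc,
      inter_eq_left.2 (Ioc_subset_Ioc hx.1 hy.2)]
  refine ⟨(μ₁ + μ₂ + μ₃).restrict (Ioc c d), inferInstance, ?_, a, b, e, ham, hbm, hem,
    ha.integrableOn, hb.integrableOn, he.integrableOn, key hα' hαe hra, key hβ' hβe hrb,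
    key hη' hηe hre⟩
  rw [Measure.restrict_apply measurableSet_Ioc.compl]
  simp

theorem sInt_eq_integral {m : Measure ℝ} [IsFiniteMeasure m] {ν : SignedMeasure ℝ} {b : ℝ → ℝ}
    (hbm : Measurable b) (hb : Integrable b m) {c d : ℝ}
    (hν : ∀ x ∈ Icc c d, ∀ y ∈ Icc c d, x ≤ y → ν (Ioc x y) = ∫ s in Ioc x y, b s ∂m)
    {h : ℝ → ℝ} (hh : Measurable h) {C : ℝ} (hC : ∀ t, ‖h t‖ ≤ C) {E : Set ℝ}
    (hE : MeasurableSet E) (hEcd : E ⊆ Ioc c d) :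
    sInt ν h E = ∫ s in E, h s * b s ∂m := by
  set P := ν.toJordanDecomposition.posPart
  set N := ν.toJordanDecomposition.negPart
  have hbp : Integrable (fun s => max (b s) 0) m := hb.pos_part
  have hbn : Integrable (fun s => max (-b s) 0) m := hb.neg_part
  set mp := m.withDensity fun s => ENNReal.ofReal (b s)
  set mn := m.withDensity fun s => ENNReal.ofReal (-b s)
  have : IsFiniteMeasure mp := isFiniteMeasure_withDensity_ofReal hb.2
  have : IsFiniteMeasure mn := isFiniteMeasure_withDensity_ofReal hb.neg.2
  have hmeas : ∀ {F : Set ℝ}, MeasurableSet F → mp.real F = ∫ s in F, max (b s) 0 ∂m ∧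
      mn.real F = ∫ s in F, max (-b s) 0 ∂m := by
    intro F hF
    have hp : ∀ g : ℝ → ℝ, Integrable (fun s => max (g s) 0) m →
        (m.withDensity fun s => ENNReal.ofReal (g s)).real F = ∫ s in F, max (g s) 0 ∂m := by
      intro g hg
      rw [measureReal_def, withDensity_apply _ hF, integral_eq_lintegral_of_nonneg_ae
        (f := fun s => max (g s) 0) (ae_of_all _ fun s => le_max_right _ _) hg.1.restrict]
      simp [ENNReal.ofReal_max]
    exact ⟨hp b hbp, hp (fun s => -b s) hbn⟩
  have heq : (P + mn).restrict (Ioc c d) = (N + mp).restrict (Ioc c d) := by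
    refine Measure.ext_of_Ioc _ _ fun x y hxy => ?_
    rw [Measure.restrict_apply measurableSet_Ioc, Measure.restrict_apply measurableSet_Ioc,
      Ioc_inter_Ioc]
    rcases lt_or_ge (min y d) (max x c) with hlt | hle
    · rw [Ioc_eq_empty (not_lt.2 hlt.le)]
      simp
    have h1 := hν (max x c) ⟨le_max_right _ _, hle.trans (min_le_right _ _)⟩ (min y d)
      ⟨(le_max_right _ _).trans hle, min_le_right _ _⟩ hle
    rw [signedMeasure_eq_sub ν measurableSet_Ioc] at h1
    obtain ⟨h2, h3⟩ := hmeas (F := Ioc (max x c) (min y d)) measurableSet_Ioc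
    have h4 : ∫ s in Ioc (max x c) (min y d), b s ∂m =
        (∫ s in Ioc (max x c) (min y d), max (b s) 0 ∂m) -
          ∫ s in Ioc (max x c) (min y d), max (-b s) 0 ∂m := by
      rw [← integral_sub hbp.integrableOn hbn.integrableOn]
      congr 1
      ext s
      rcases le_total (b s) 0 with hs | hs
      · rw [max_eq_right hs, max_eq_left (by linarith)]; ring
      · rw [max_eq_left hs, max_eq_right (by linarith)]; ring
    rw [← measureReal_eq_measureReal_iff (measure_ne_top _ _) (measure_ne_top _ _),
      measureReal_add_apply, measureReal_add_apply]
    linarith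
  have hint : ∀ (μ : Measure ℝ) [IsFiniteMeasure μ], Integrable h μ := fun μ _ =>
    Integrable.of_bound hh.aestronglyMeasurable C (ae_of_all _ hC)
  have heqE : (P + mn).restrict E = (N + mp).restrict E := by
    have := congrArg (fun μ => μ.restrict E) heq
    simpa only [Measure.restrict_restrict hE, inter_eq_left.2 hEcd] using this
  have h5 : (∫ s in E, h s ∂P) + ∫ s in E, h s ∂mn = (∫ s in E, h s ∂N) + ∫ s in E, h s ∂mp := by
    rw [← integral_add_measure (hint _) (hint _), ← integral_add_measure (hint _) (hint _),
      ← Measure.restrict_add, ← Measure.restrict_add, heqE]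
  have h6 : ∫ s in E, h s ∂mp = ∫ s in E, h s * max (b s) 0 ∂m := by
    rw [setIntegral_withDensity_eq_setIntegral_toReal_smul hbm.ennreal_ofReal (by simp) _ hE]
    simp only [ENNReal.toReal_ofReal', smul_eq_mul, mul_comm]
  have h7 : ∫ s in E, h s ∂mn = ∫ s in E, h s * max (-b s) 0 ∂m := by
    have hbn' : Measurable fun s => ENNReal.ofReal (-b s) := hbm.neg.ennreal_ofReal
    rw [setIntegral_withDensity_eq_setIntegral_toReal_smul hbn' (by simp) _ hE]
    simp only [ENNReal.toReal_ofReal', smul_eq_mul, mul_comm]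
  have h8 : ∫ s in E, h s * b s ∂m = (∫ s in E, h s * max (b s) 0 ∂m) -
      ∫ s in E, h s * max (-b s) 0 ∂m := by
    rw [← integral_sub (hbp.bdd_mul hh.aestronglyMeasurable (ae_of_all _ hC)).integrableOn
      (hbn.bdd_mul hh.aestronglyMeasurable (ae_of_all _ hC)).integrableOn]
    congr 1
    ext s
    rcases le_total (b s) 0 with hs | hs
    · rw [max_eq_right hs, max_eq_left (by linarith)]; ring
    · rw [max_eq_left hs, max_eq_right (by linarith)]; ring
  rw [h8, ← h6, ← h7]
  unfold sInt
  linarith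

/-- The localization of `MeasureEqOn` to a single interval `(c,d]`. -/
def MeasureEqAt {ι : Type} [Fintype ι] (c d : ℝ) (g : ℝ → ℝ) (h β : ι → ℝ → ℝ) : Prop :=
  ∃ (νg : SignedMeasure ℝ) (ν : ι → SignedMeasure ℝ),
    SMRepresents νg g c d ∧ (∀ j, SMRepresents (ν j) (β j) c d) ∧
    ∀ E : Set ℝ, E ⊆ Ioc c d → MeasurableSet E → νg E = ∑ j, sInt (ν j) (h j) E

theorem measureEqAt_iff {ι : Type} [Fintype ι] {m : Measure ℝ} [IsFiniteMeasure m] {c d : ℝ}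
    {g : ℝ → ℝ} {h β b H : ι → ℝ → ℝ} (hbm : ∀ j, Measurable (b j))
    (hb : ∀ j, Integrable (b j) m) (hβ : ∀ j, HasDensity m (β j) (b j) c d)
    (hH : ∀ j, Measurable (H j)) (hC : ∀ j, ∃ C, ∀ t, ‖H j t‖ ≤ C)
    (hh : ∀ j, EqOn (h j) (H j) (Icc c d)) :
    MeasureEqAt c d g h β ↔ HasDensity m g (fun s => ∑ j, H j s * b j s) c d := by
  have hi : ∀ j, Integrable (fun s => H j s * b j s) m := fun j => by
    obtain ⟨C, hC⟩ := hC j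
    exact (hb j).bdd_mul (hH j).aestronglyMeasurable (ae_of_all _ hC)
  have key : ∀ ν : ι → SignedMeasure ℝ, (∀ j, SMRepresents (ν j) (β j) c d) →
      ∀ E : Set ℝ, E ⊆ Ioc c d → MeasurableSet E →
        ∑ j, sInt (ν j) (h j) E = ∫ s in E, ∑ j, H j s * b j s ∂m := by
    intro ν hν E hE hEm
    rw [integral_finsetSum _ fun j _ => (hi j).integrableOn]
    refine Finset.sum_congr rfl fun j _ => ?_
    obtain ⟨C, hC⟩ := hC j
    have hcongr : sInt (ν j) (h j) E = sInt (ν j) (H j) E := by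
      have hEq : EqOn (h j) (H j) E := (hh j).mono (hE.trans Ioc_subset_Icc_self)
      unfold sInt
      rw [setIntegral_congr_fun hEm hEq, setIntegral_congr_fun hEm hEq]
    rw [hcongr]
    exact sInt_eq_integral (hbm j) (hb j)
      (fun x hx y hy hxy => by rw [hν j x hx y hy hxy, hβ j x hx y hy hxy]) (hH j) hC hEm hE
  constructor
  · rintro ⟨νg, ν, hg, hν, hE⟩ x hx y hy hxy
    have hsub : Ioc x y ⊆ Ioc c d := Ioc_subset_Ioc hx.1 hy.2
    rw [← hg x hx y hy hxy, hE _ hsub measurableSet_Ioc, key ν hν _ hsub measurableSet_Ioc]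
  · intro hg
    have hsum : Integrable (fun s => ∑ j, H j s * b j s) m := integrable_finsetSum _ fun j _ => hi j
    have hν : ∀ j, SMRepresents (m.withDensityᵥ (b j)) (β j) c d := fun j x hx y hy hxy => by
      rw [withDensityᵥ_apply (hb j) measurableSet_Ioc, hβ j x hx y hy hxy]
    refine ⟨m.withDensityᵥ fun s => ∑ j, H j s * b j s, fun j => m.withDensityᵥ (b j),
      fun x hx y hy hxy => ?_, hν, fun E hE hEm => ?_⟩
    · rw [withDensityᵥ_apply hsum measurableSet_Ioc, hg x hx y hy hxy]
    · rw [withDensityᵥ_apply hsum hEm, key _ hν E hE hEm]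

theorem hasDensity_iff_re_im {m : Measure ℝ} {g h : ℝ → ℂ} {c d : ℝ} (hh : Integrable h m)
    (hg : ∀ x ∈ Icc c d, Tendsto g (𝓝[>] x) (𝓝 (rightLim g x))) :
    HasDensity m g h c d ↔ HasDensity m (fun s => (g s).re) (fun s => (h s).re) c d ∧
      HasDensity m (fun s => (g s).im) (fun s => (h s).im) c d := by
  have key : ∀ x ∈ Icc c d, ∀ y ∈ Icc c d,
      (rightLim g y - rightLim g x = ∫ s in Ioc x y, h s ∂m) ↔
      (rightLim (fun s => (g s).re) y - rightLim (fun s => (g s).re) x =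
        ∫ s in Ioc x y, (h s).re ∂m) ∧
      (rightLim (fun s => (g s).im) y - rightLim (fun s => (g s).im) x =
        ∫ s in Ioc x y, (h s).im ∂m) := by
    intro x hx y hy
    rw [(rightLim_re_im (hg x hx)).1, (rightLim_re_im (hg x hx)).2, (rightLim_re_im (hg y hy)).1,
      (rightLim_re_im (hg y hy)).2, integral_re_im hh.integrableOn, Complex.ext_iff]
    simp
  constructor
  · exact fun H => ⟨fun x hx y hy hxy => ((key x hx y hy).1 (H x hx y hy hxy)).1,
      fun x hx y hy hxy => ((key x hx y hy).1 (H x hx y hy hxy)).2⟩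
  · exact fun H x hx y hy hxy =>
      (key x hx y hy).2 ⟨H.1 x hx y hy hxy, H.2 x hx y hy hxy⟩

theorem measureEqAt_re_im_iff {ι : Type} [Fintype ι] {m : Measure ℝ} [IsFiniteMeasure m] {c d : ℝ}
    {g : ℝ → ℂ} {h β b H : ι → ℝ → ℂ} (hbm : ∀ j, Measurable (b j))
    (hb : ∀ j, Integrable (b j) m) (hβ : ∀ j, HasDensity m (β j) (b j) c d)
    (hH : ∀ j, BddMeas (H j)) (hh : ∀ j, EqOn (h j) (H j) (Icc c d))
    (hg : ∀ x ∈ Icc c d, Tendsto g (𝓝[>] x) (𝓝 (rightLim g x)))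
    (hβt : ∀ j, ∀ x ∈ Icc c d, Tendsto (β j) (𝓝[>] x) (𝓝 (rightLim (β j) x))) :
    (MeasureEqAt c d (fun x => (g x).re)
        (Sum.elim (fun j x => (h j x).re) (fun j x => -(h j x).im))
        (Sum.elim (fun j x => (β j x).re) (fun j x => (β j x).im)) ∧
      MeasureEqAt c d (fun x => (g x).im)
        (Sum.elim (fun j x => (h j x).im) (fun j x => (h j x).re))
        (Sum.elim (fun j x => (β j x).re) (fun j x => (β j x).im))) ↔
    HasDensity m g (fun s => ∑ j, H j s * b j s) c d := by
  have hHre : ∀ j, Measurable fun x => (H j x).re := fun j =>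
    Complex.measurable_re.comp (hH j).1.measurable
  have hHim : ∀ j, Measurable fun x => (H j x).im := fun j =>
    Complex.measurable_im.comp (hH j).1.measurable
  have hCre : ∀ j, ∃ C, ∀ t, ‖(H j t).re‖ ≤ C := fun j =>
    (hH j).2.imp fun C hC t => (Complex.abs_re_le_norm _).trans (hC t)
  have hCim : ∀ j, ∃ C, ∀ t, ‖(H j t).im‖ ≤ C := fun j =>
    (hH j).2.imp fun C hC t => (Complex.abs_im_le_norm _).trans (hC t)
  have hβ' := fun j => (hasDensity_iff_re_im (hb j) (hβt j)).1 (hβ j)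
  have hsum : Integrable (fun s => ∑ j, H j s * b j s) m := integrable_finsetSum _ fun j _ => by
    obtain ⟨C, hC⟩ := (hH j).2
    exact (hb j).bdd_mul (hH j).1.aestronglyMeasurable (ae_of_all _ hC)
  have hbm' : ∀ j, Measurable
      (Sum.elim (fun j x => (b j x).re) (fun j x => (b j x).im) j : ℝ → ℝ) := by
    rintro (j | j)
    exacts [Complex.measurable_re.comp (hbm j), Complex.measurable_im.comp (hbm j)]
  have hb' : ∀ j, Integrable
      (Sum.elim (fun j x => (b j x).re) (fun j x => (b j x).im) j : ℝ → ℝ) m := by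
    rintro (j | j)
    exacts [(hb j).re, (hb j).im]
  have hβ'' : ∀ j, HasDensity m (Sum.elim (fun j x => (β j x).re) (fun j x => (β j x).im) j)
      (Sum.elim (fun j x => (b j x).re) (fun j x => (b j x).im) j : ℝ → ℝ) c d := by
    rintro (j | j)
    exacts [(hβ' j).1, (hβ' j).2]
  rw [measureEqAt_iff (m := m)
      (H := Sum.elim (fun j x => (H j x).re) (fun j x => -(H j x).im)) hbm' hb' hβ''
      (by rintro (j | j); exacts [hHre j, (hHim j).neg])
      (by rintro (j | j); exacts [hCre j, by simpa using hCim j])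
      (by rintro (j | j) x hx <;> simp [hh j hx]),
    measureEqAt_iff (m := m)
      (H := Sum.elim (fun j x => (H j x).im) (fun j x => (H j x).re)) hbm' hb' hβ''
      (by rintro (j | j); exacts [hHim j, hHre j])
      (by rintro (j | j); exacts [hCim j, hCre j])
      (by rintro (j | j) x hx <;> simp [hh j hx]),
    hasDensity_iff_re_im hsum hg]
  simp only [Fintype.sum_sum_type, Sum.elim_inl, Sum.elim_inr, ← Finset.sum_add_distrib,
    Complex.re_sum, Complex.im_sum, Complex.mul_re, Complex.mul_im, neg_mul, ← sub_eq_add_neg,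
    add_comm]

theorem HasDensity.mono {E : Type*} [NormedAddCommGroup E] [NormedSpace ℝ E] {m : Measure ℝ}
    {f h : ℝ → E} {c d c' d' : ℝ} (hf : HasDensity m f h c d) (hc : c ≤ c') (hd : d' ≤ d) :
    HasDensity m f h c' d' :=
  fun x hx y hy hxy => hf x ⟨hc.trans hx.1, hx.2.trans hd⟩ y ⟨hc.trans hy.1, hy.2.trans hd⟩ hxy

theorem measureEqOnC_iff {I : Set ℝ} {ι : Type} [Fintype ι] {g : ℝ → ℂ} {h β : ι → ℝ → ℂ} :
    MeasureEqOnC I g h β ↔ ∀ c ∈ I, ∀ d ∈ I, c < d →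
      MeasureEqAt c d (fun x => (g x).re)
        (Sum.elim (fun j x => (h j x).re) (fun j x => -(h j x).im))
        (Sum.elim (fun j x => (β j x).re) (fun j x => (β j x).im)) ∧
      MeasureEqAt c d (fun x => (g x).im)
        (Sum.elim (fun j x => (h j x).im) (fun j x => (h j x).re))
        (Sum.elim (fun j x => (β j x).re) (fun j x => (β j x).im)) :=
  ⟨fun H c hc d hd hcd => ⟨H.1 c hc d hd hcd, H.2 c hc d hd hcd⟩,
    fun H => ⟨fun c hc d hd hcd => (H c hc d hd hcd).1, fun c hc d hd hcd => (H c hc d hd hcd).2⟩⟩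

theorem BddMeas.const (z : ℂ) : BddMeas fun _ : ℝ => z :=
  ⟨stronglyMeasurable_const, ‖z‖, fun _ => le_rfl⟩

/-- Measure-theoretic data representing `dα`, `dβ`, `dη` on `(c,d]` by densities. -/
structure DensityData (m : Measure ℝ) (α β η a b e : ℝ → ℂ) (c d : ℝ) : Prop where
  fin : IsFiniteMeasure m
  null : m (Ioc c d)ᶜ = 0
  ma : Measurable a
  mb : Measurable b
  me : Measurable e
  ia : Integrable a m
  ib : Integrable b m
  ie : Integrable e m
  da : HasDensity m α a c d
  db : HasDensity m β b c d
  de : HasDensity m η e c d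

section

variable {I : Set ℝ} {r : ℂ} {α β η u w a b e U W : ℝ → ℂ} {m : Measure ℝ} {c d : ℝ}

theorem measureEqAt_iff_hasDensity (hI : IsOpen I) (hI' : I.OrdConnected)
    (hα : LocallyBoundedVariationOn α I) (hβ : LocallyBoundedVariationOn β I)
    (hη : LocallyBoundedVariationOn η I) (hu : LocallyBoundedVariationOn u I)
    (hw : LocallyBoundedVariationOn w I) {c' d' : ℝ}
    (D : DensityData m α β η a b e c' d') (hc' : c' ≤ c) (hd' : d ≤ d')
    (hU : BddMeas U) (hW : BddMeas W) (huU : EqOn u U (Icc c d)) (hwW : EqOn w W (Icc c d))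
    (hc : c ∈ I) (hd : d ∈ I) :
    ((MeasureEqAt c d (fun x => (u x).re)
        (Sum.elim (fun (_ : Fin 1) x => (w x).re) (fun (_ : Fin 1) x => -(w x).im))
        (Sum.elim (fun (_ : Fin 1) x => (α x).re) (fun (_ : Fin 1) x => (α x).im)) ∧
      MeasureEqAt c d (fun x => (u x).im)
        (Sum.elim (fun (_ : Fin 1) x => (w x).im) (fun (_ : Fin 1) x => (w x).re))
        (Sum.elim (fun (_ : Fin 1) x => (α x).re) (fun (_ : Fin 1) x => (α x).im))) ↔
      HasDensity m u (fun s => W s * a s) c d) ∧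
    ((MeasureEqAt c d (fun x => (w x).re)
        (Sum.elim (fun j x => ((![u, fun _ => (-1 : ℂ)] : Fin 2 → ℝ → ℂ) j x).re)
          (fun j x => -((![u, fun _ => (-1 : ℂ)] : Fin 2 → ℝ → ℂ) j x).im))
        (Sum.elim (fun j x => ((![β, η] : Fin 2 → ℝ → ℂ) j x).re)
          (fun j x => ((![β, η] : Fin 2 → ℝ → ℂ) j x).im)) ∧
      MeasureEqAt c d (fun x => (w x).im)
        (Sum.elim (fun j x => ((![u, fun _ => (-1 : ℂ)] : Fin 2 → ℝ → ℂ) j x).im)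
          (fun j x => ((![u, fun _ => (-1 : ℂ)] : Fin 2 → ℝ → ℂ) j x).re))
        (Sum.elim (fun j x => ((![β, η] : Fin 2 → ℝ → ℂ) j x).re)
          (fun j x => ((![β, η] : Fin 2 → ℝ → ℂ) j x).im))) ↔
      HasDensity m w (fun s => U s * b s - e s) c d) := by
  have := D.fin
  have ht : ∀ {f : ℝ → ℂ}, LocallyBoundedVariationOn f I → ∀ x ∈ Icc c d,
      Tendsto f (𝓝[>] x) (𝓝 (rightLim f x)) := fun hf x hx =>
    (hf.tendsto_lims hI hI' (hI'.out hc hd hx)).1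
  constructor
  · rw [measureEqAt_re_im_iff (m := m) (h := fun _ : Fin 1 => w) (β := fun _ : Fin 1 => α)
      (b := fun _ => a) (H := fun _ => W) (fun _ => D.ma) (fun _ => D.ia)
      (fun _ => D.da.mono hc' hd') (fun _ => hW) (fun _ => hwW) (ht hu) (fun _ => ht hα)]
    simp
  · rw [measureEqAt_re_im_iff (m := m) (h := ![u, fun _ => (-1 : ℂ)]) (β := ![β, η])
      (b := ![b, e]) (H := ![U, fun _ => -1])
      (Fin.forall_fin_two.2 ⟨D.mb, D.me⟩) (Fin.forall_fin_two.2 ⟨D.ib, D.ie⟩)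
      (Fin.forall_fin_two.2 ⟨D.db.mono hc' hd', D.de.mono hc' hd'⟩)
      (Fin.forall_fin_two.2 ⟨hU, BddMeas.const _⟩)
      (Fin.forall_fin_two.2 ⟨huU, fun _ _ => rfl⟩) (ht hw) (Fin.forall_fin_two.2 ⟨ht hβ, ht hη⟩)]
    simp [sub_eq_add_neg]

end

theorem tendsto_setIntegral_of_eventually_mem_iff {m : Measure ℝ} {h : ℝ → ℂ}
    (hh : Integrable h m) {l : Filter ℝ} [l.IsCountablyGenerated] {S : ℝ → Set ℝ} {T : Set ℝ}
    (hS : ∀ s, MeasurableSet (S s)) (hT : MeasurableSet T)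
    (hST : ∀ x, ∀ᶠ s in l, x ∈ S s ↔ x ∈ T) :
    Tendsto (fun s => ∫ x in S s, h x ∂m) l (𝓝 (∫ x in T, h x ∂m)) := by
  simp only [← integral_indicator (hS _), ← integral_indicator hT]
  refine tendsto_integral_filter_of_dominated_convergence (fun x => ‖h x‖)
    (Eventually.of_forall fun s => hh.1.indicator (hS s))
    (Eventually.of_forall fun s => ae_of_all _ fun x => norm_indicator_le_norm_self _ _)
    hh.norm (ae_of_all _ fun x => ?_)
  refine tendsto_const_nhds.congr' ?_
  filter_upwards [hST x] with s hs
  by_cases hx : x ∈ T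
  · rw [indicator_of_mem hx, indicator_of_mem (hs.2 hx)]
  · rw [indicator_of_notMem hx, indicator_of_notMem (mt hs.1 hx)]

theorem tendsto_setIntegral_Iic_Iio {m : Measure ℝ} {h : ℝ → ℂ} (hh : Integrable h m) (t : ℝ) :
    (Tendsto (fun s => ∫ x in Iic s, h x ∂m) (𝓝[<] t) (𝓝 (∫ x in Iio t, h x ∂m)) ∧
      Tendsto (fun s => ∫ x in Iio s, h x ∂m) (𝓝[<] t) (𝓝 (∫ x in Iio t, h x ∂m))) ∧
    (Tendsto (fun s => ∫ x in Iic s, h x ∂m) (𝓝[>] t) (𝓝 (∫ x in Iic t, h x ∂m)) ∧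
      Tendsto (fun s => ∫ x in Iio s, h x ∂m) (𝓝[>] t) (𝓝 (∫ x in Iic t, h x ∂m))) := by
  have hl : ∀ x, ∀ᶠ s in 𝓝[<] t, s < t ∧ (x < t → x < s) := fun x => by
    by_cases hx : x < t
    · filter_upwards [Ioo_mem_nhdsLT hx] with s hs using ⟨hs.2, fun _ => hs.1⟩
    · filter_upwards [self_mem_nhdsWithin] with s hs using ⟨hs, fun h => absurd h hx⟩
  have hr : ∀ x, ∀ᶠ s in 𝓝[>] t, t < s ∧ (t < x → s < x) := fun x => by
    by_cases hx : t < x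
    · filter_upwards [Ioo_mem_nhdsGT hx] with s hs using ⟨hs.1, fun _ => hs.2⟩
    · filter_upwards [self_mem_nhdsWithin] with s hs using ⟨hs, fun h => absurd h hx⟩
  refine ⟨⟨?_, ?_⟩, ?_, ?_⟩
  · exact tendsto_setIntegral_of_eventually_mem_iff hh (fun _ => measurableSet_Iic)
      measurableSet_Iio fun x => (hl x).mono fun s hs =>
        ⟨fun h => lt_of_le_of_lt h hs.1, fun h => (hs.2 h).le⟩
  · exact tendsto_setIntegral_of_eventually_mem_iff hh (fun _ => measurableSet_Iio)
      measurableSet_Iio fun x => (hl x).mono fun s hs =>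
        ⟨fun h => lt_trans h hs.1, fun h => hs.2 h⟩
  · exact tendsto_setIntegral_of_eventually_mem_iff hh (fun _ => measurableSet_Iic)
      measurableSet_Iic fun x => (hr x).mono fun s hs =>
        ⟨fun h => not_lt.1 fun h' => (hs.2 h').not_ge h, fun h => h.trans hs.1.le⟩
  · exact tendsto_setIntegral_of_eventually_mem_iff hh (fun _ => measurableSet_Iio)
      measurableSet_Iic fun x => (hr x).mono fun s hs =>
        ⟨fun h => not_lt.1 fun h' => (hs.2 h').not_gt h, fun h => lt_of_le_of_lt h hs.1⟩

theorem HasDensity.lims {m : Measure ℝ} {I : Set ℝ} (hI : IsOpen I)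
    (hI' : I.OrdConnected) {f h : ℝ → ℂ} {c d : ℝ} (hf : LocallyBoundedVariationOn f I)
    (hc : c ∈ I) (hd : d ∈ I) (hm : m (Ioc c d)ᶜ = 0) (hh : Integrable h m)
    (hD : HasDensity m f h c d) {t : ℝ} (ht : t ∈ Ioc c d) :
    rightLim f t = rightLim f c + ∫ s in Iic t, h s ∂m ∧
      leftLim f t = rightLim f c + ∫ s in Iio t, h s ∂m := by
  have key : ∀ s ∈ Icc c d, rightLim f s = rightLim f c + ∫ x in Iic s, h x ∂m := by
    intro s hs
    have h1 := hD c ⟨le_rfl, hs.1.trans hs.2⟩ s hs hs.1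
    have h2 : (Ioc c s : Set ℝ) =ᵐ[m] Iic s := by
      have h3 : ∀ᵐ x ∂m, x ∈ Ioc c d := by
        rw [ae_iff]
        exact hm
      filter_upwards [h3] with x hx
      exact propext ⟨fun h => h.2, fun h => ⟨hx.1, h⟩⟩
    rw [setIntegral_congr_set h2] at h1
    rw [← h1]
    ring
  refine ⟨key t ⟨ht.1.le, ht.2⟩, ?_⟩
  rw [← leftLim_rightLim (hf.tendsto_lims hI hI' (hI'.out hc hd ⟨ht.1.le, ht.2⟩)).2]
  refine leftLim_eq_of_tendsto (((tendsto_setIntegral_Iic_Iio hh t).1.1.const_add _).congr' ?_)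
  filter_upwards [Ioo_mem_nhdsLT ht.1] with s hs
  rw [key s ⟨hs.1.le, hs.2.le.trans ht.2⟩]

theorem setIntegral_Iic_eq_add {m : Measure ℝ} [IsFiniteMeasure m] {h : ℝ → ℂ}
    (hh : Integrable h m) (t : ℝ) :
    ∫ s in Iic t, h s ∂m = (∫ s in Iio t, h s ∂m) + h t * m.real {t} := by
  rw [← atom_eq_integral, ← setIntegral_union (by simp) (measurableSet_singleton t)
    hh.integrableOn hh.integrableOn, Iio_union_right]

theorem HasDensity.jumpC_eq {m : Measure ℝ} [IsFiniteMeasure m] {I : Set ℝ} (hI : IsOpen I)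
    (hI' : I.OrdConnected) {f h : ℝ → ℂ} {c d : ℝ} (hf : LocallyBoundedVariationOn f I)
    (hc : c ∈ I) (hd : d ∈ I) (hm : m (Ioc c d)ᶜ = 0) (hh : Integrable h m)
    (hD : HasDensity m f h c d) {t : ℝ} (ht : t ∈ Ioc c d) :
    jumpC f t = h t * m.real {t} := by
  obtain ⟨h1, h2⟩ := hD.lims hI hI' hf hc hd hm hh ht
  rw [jumpC, h1, h2, setIntegral_Iic_eq_add hh]
  ring

theorem HasDensity.eq_balPrim {m : Measure ℝ} {I : Set ℝ} (hI : IsOpen I)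
    (hI' : I.OrdConnected) {r : ℂ} {f h : ℝ → ℂ} {c d : ℝ} (hf : RBalancedC r I f)
    (hc : c ∈ I) (hd : d ∈ I) (hm : m (Ioc c d)ᶜ = 0) (hh : Integrable h m)
    (hD : HasDensity m f h c d) {t : ℝ} (ht : t ∈ Ioc c d) :
    f t = rightLim f c + balPrim m r h t := by
  obtain ⟨h1, h2⟩ := hD.lims hI hI' hf.1 hc hd hm hh ht
  rw [hf.2 t (hI'.out hc hd ⟨ht.1.le, ht.2⟩), h1, h2, balPrim]
  ring

theorem locallyBoundedVariationOn_balPrim {m : Measure ℝ} {h : ℝ → ℂ} (hh : Integrable h m)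
    (r : ℂ) (I : Set ℝ) : LocallyBoundedVariationOn (balPrim m r h) I := by
  have hmono : ∀ S T : Set ℝ, S ⊆ T → MeasurableSet T → MeasurableSet S →
      ‖(∫ s in T, h s ∂m) - ∫ s in S, h s ∂m‖ ≤
        (∫ s in T, ‖h s‖ ∂m) - ∫ s in S, ‖h s‖ ∂m := by
    intro S T hST hT hS
    rw [← setIntegral_sdiff hS hh.integrableOn hST, ← setIntegral_sdiff hS hh.norm.integrableOn hST]
    exact norm_integral_le_integral_norm _
  set N : ℝ → ℝ := fun t => ‖r‖ * (∫ s in Iio t, ‖h s‖ ∂m) +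
    ‖1 - r‖ * (∫ s in Iic t, ‖h s‖ ∂m) with hN
  have hle : ∀ x y, x ≤ y → ‖balPrim m r h y - balPrim m r h x‖ ≤ N y - N x := by
    intro x y hxy
    have h1 := hmono _ _ (Iio_subset_Iio hxy) measurableSet_Iio measurableSet_Iio
    have h2 := hmono _ _ (Iic_subset_Iic.2 hxy) measurableSet_Iic measurableSet_Iic
    have e : balPrim m r h y - balPrim m r h x =
        r * ((∫ s in Iio y, h s ∂m) - ∫ s in Iio x, h s ∂m) +
          (1 - r) * ((∫ s in Iic y, h s ∂m) - ∫ s in Iic x, h s ∂m) := by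
      rw [balPrim, balPrim]
      ring
    rw [e]
    refine (norm_add_le _ _).trans ?_
    rw [norm_mul, norm_mul]
    have h3 := mul_le_mul_of_nonneg_left h1 (norm_nonneg r)
    have h4 := mul_le_mul_of_nonneg_left h2 (norm_nonneg (1 - r))
    simp only [hN]
    linarith
  have hNm : Monotone N := fun x y hxy => sub_nonneg.1 ((norm_nonneg _).trans (hle x y hxy))
  intro p q hp hq
  refine ne_top_of_le_ne_top ((hNm.monotoneOn I).locallyBoundedVariationOn p q hp hq) ?_
  refine iSup_le fun z => (Finset.sum_le_sum fun i _ => ?_).trans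
    (eVariationOn.sum_le (n := z.1) z.2.2.1 fun i => z.2.2.2 i)
  have hz : (z.2 : ℕ → ℝ) i ≤ (z.2 : ℕ → ℝ) (i + 1) := z.2.2.1 i.le_succ
  rw [edist_dist, edist_dist, dist_eq_norm, Real.dist_eq]
  exact ENNReal.ofReal_le_ofReal ((hle _ _ hz).trans (le_abs_self _))

theorem balPrim_solution {m : Measure ℝ} {h f : ℝ → ℂ} (hh : Integrable h m) {r K : ℂ}
    (hf : ∀ t, f t = K + balPrim m r h t) (I : Set ℝ) (c d : ℝ) :
    RBalancedC r I f ∧ HasDensity m f h c d := by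
  have hl : ∀ t, rightLim f t = K + ∫ s in Iic t, h s ∂m ∧
      leftLim f t = K + ∫ s in Iio t, h s ∂m := by
    intro t
    obtain ⟨⟨h1, h2⟩, h3, h4⟩ := tendsto_setIntegral_Iic_Iio hh t
    have e1 := ((h4.const_mul r).add (h3.const_mul (1 - r))).const_add K
    have e2 := ((h2.const_mul r).add (h1.const_mul (1 - r))).const_add K
    constructor
    · refine rightLim_eq_of_tendsto ?_
      convert e1 using 1
      · exact funext hf
      · congr 1; ring
    · refine leftLim_eq_of_tendsto ?_
      convert e2 using 1
      · exact funext hf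
      · congr 1; ring
  refine ⟨⟨fun p q hp hq => ?_, fun x _ => ?_⟩, fun x _ y _ hxy => ?_⟩
  · refine ne_top_of_le_ne_top (locallyBoundedVariationOn_balPrim hh r I p q hp hq) (le_of_eq ?_)
    refine iSup_congr fun z => Finset.sum_congr rfl fun i _ => ?_
    rw [hf, hf, edist_add_left]
  · rw [(hl x).1, (hl x).2, hf, balPrim]
    ring
  · rw [(hl x).1, (hl y).1, add_sub_add_left_eq_sub, ← setIntegral_sdiff measurableSet_Iic
      hh.integrableOn (Iic_subset_Iic.2 hxy), Iic_sdiff_Iic]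

theorem LocallyBoundedVariationOn.mono {E : Type*} [PseudoEMetricSpace E] {f : ℝ → E}
    {I J : Set ℝ} (hf : LocallyBoundedVariationOn f I) (hJ : J ⊆ I) :
    LocallyBoundedVariationOn f J := fun p q hp hq =>
  ne_top_of_le_ne_top (hf p q (hJ hp) (hJ hq))
    (eVariationOn.mono _ (inter_subset_inter_left _ hJ))

section

variable {I : Set ℝ} {r : ℂ} {α β η u w u' w' a b e : ℝ → ℂ} {m : Measure ℝ} {c d : ℝ}

theorem exists_densityData (hI : IsOpen I) (hI' : I.OrdConnected)
    (hα : LocallyBoundedVariationOn α I) (hβ : LocallyBoundedVariationOn β I)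
    (hη : LocallyBoundedVariationOn η I) (hc : c ∈ I) (hd : d ∈ I) :
    ∃ (m : Measure ℝ) (a b e : ℝ → ℂ), DensityData m α β η a b e c d := by
  obtain ⟨m, h1, h2, a, b, e, h3, h4, h5, h6, h7, h8, h9, h10, h11⟩ :=
    exists_densities hI hI' hα hβ hη hc hd
  exact ⟨m, a, b, e, h1, h2, h3, h4, h5, h6, h7, h8, h9, h10, h11⟩

theorem DensityData.det_ne_zero (D : DensityData m α β η a b e c d) (hI : IsOpen I)
    (hI' : I.OrdConnected) (hα : LocallyBoundedVariationOn α I)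
    (hβ : LocallyBoundedVariationOn β I) (hc : c ∈ I) (hd : d ∈ I)
    (hθ : ∀ x ∈ I, 1 - (1 - r) ^ 2 * jumpC α x * jumpC β x ≠ 0 ∧
      1 - r ^ 2 * jumpC α x * jumpC β x ≠ 0) (t : ℝ) :
    1 - (1 - r) ^ 2 * (a t * m.real {t}) * (b t * m.real {t}) ≠ 0 ∧
      1 - r ^ 2 * (a t * m.real {t}) * (b t * m.real {t}) ≠ 0 := by
  have := D.fin
  by_cases ht : t ∈ Ioc c d
  · rw [← D.da.jumpC_eq hI hI' hα hc hd D.null D.ia ht,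
      ← D.db.jumpC_eq hI hI' hβ hc hd D.null D.ib ht]
    exact hθ t (hI'.out hc hd ⟨ht.1.le, ht.2⟩)
  · have h0 : m.real {t} = 0 := by
      rw [measureReal_def, measure_mono_null (singleton_subset_iff.2 ht) D.null,
        ENNReal.toReal_zero]
    simp [h0]

theorem IsSolC.exists_hasDensity (hI : IsOpen I) (hI' : I.OrdConnected)
    (hα : LocallyBoundedVariationOn α I) (hβ : LocallyBoundedVariationOn β I)
    (hη : LocallyBoundedVariationOn η I) (h : IsSolC I r α β η u w)
    (D : DensityData m α β η a b e c d) (hc : c ∈ I) (hd : d ∈ I) (hcd : c < d) :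
    ∃ U W : ℝ → ℂ, BddMeas U ∧ BddMeas W ∧ EqOn u U (Icc c d) ∧ EqOn w W (Icc c d) ∧
      HasDensity m u (fun s => W s * a s) c d ∧ HasDensity m w (fun s => U s * b s - e s) c d := by
  obtain ⟨U, hU, huU⟩ := exists_clamp hI hI' h.1.1 hc hd
  obtain ⟨W, hW, hwW⟩ := exists_clamp hI hI' h.2.1.1 hc hd
  have hu' : EqOn u U (Icc c d) := fun x hx => (huU x hx).eq_of_nhds
  have hw' : EqOn w W (Icc c d) := fun x hx => (hwW x hx).eq_of_nhds
  have key := measureEqAt_iff_hasDensity hI hI' hα hβ hη h.1.1 h.2.1.1 D le_rfl le_rfl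
    hU.bddMeas hW.bddMeas hu' hw' hc hd
  exact ⟨U, W, hU.bddMeas, hW.bddMeas, hu', hw',
    key.1.1 (measureEqOnC_iff.1 h.2.2.1 c hc d hd hcd),
    key.2.1 (measureEqOnC_iff.1 h.2.2.2 c hc d hd hcd)⟩

theorem isSolC_of_hasDensity (hI : IsOpen I) (hI' : I.OrdConnected)
    (hα : LocallyBoundedVariationOn α I) (hβ : LocallyBoundedVariationOn β I)
    (hη : LocallyBoundedVariationOn η I) (hu : RBalancedC r I u) (hw : RBalancedC r I w)
    (H : ∀ c ∈ I, ∀ d ∈ I, c < d → ∃ (m : Measure ℝ) (a b e U W : ℝ → ℂ) (c' d' : ℝ),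
      DensityData m α β η a b e c' d' ∧ c' ≤ c ∧ d ≤ d' ∧ BddMeas U ∧ BddMeas W ∧
      EqOn u U (Icc c d) ∧ EqOn w W (Icc c d) ∧
      HasDensity m u (fun s => W s * a s) c d ∧
      HasDensity m w (fun s => U s * b s - e s) c d) :
    IsSolC I r α β η u w := by
  refine ⟨hu, hw, measureEqOnC_iff.2 fun c hc d hd hcd => ?_,
    measureEqOnC_iff.2 fun c hc d hd hcd => ?_⟩
  all_goals
    obtain ⟨m, a, b, e, U, W, c', d', D, h1, h2, hU, hW, huU, hwW, h3, h4⟩ := H c hc d hd hcd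
    have key := measureEqAt_iff_hasDensity hI hI' hα hβ hη hu.1 hw.1 D h1 h2 hU hW huU hwW hc hd
  · exact key.1.2 h3
  · exact key.2.2 h4

theorem exists_isSolC_Ioo (hI : IsOpen I) (hI' : I.OrdConnected)
    (hα : LocallyBoundedVariationOn α I) (hβ : LocallyBoundedVariationOn β I)
    (hη : LocallyBoundedVariationOn η I)
    (hθ : ∀ x ∈ I, 1 - (1 - r) ^ 2 * jumpC α x * jumpC β x ≠ 0 ∧
      1 - r ^ 2 * jumpC α x * jumpC β x ≠ 0) (hc : c ∈ I) (hd : d ∈ I) (x₀ : ℝ) (A B : ℂ) :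
    ∃ u w : ℝ → ℂ, IsSolC (Ioo c d) r α β η u w ∧ u x₀ = A ∧ w x₀ = B := by
  obtain ⟨m, a, b, e, D⟩ := exists_densityData hI hI' hα hβ hη hc hd
  have := D.fin
  obtain ⟨u, w, hu, hw, hu', hw'⟩ := exists_integral_solution m D.ma D.mb D.me D.ia D.ib D.ie r x₀
    (D.det_ne_zero hI hI' hα hβ hc hd hθ) A B
  have hsub : Ioo c d ⊆ I := Ioo_subset_Icc_self.trans (hI'.out hc hd)
  have hiu : Integrable (fun s => w s * a s) m := by
    obtain ⟨C, hC⟩ := hw.2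
    exact D.ia.bdd_mul hw.1.aestronglyMeasurable (ae_of_all _ hC)
  have hiw : Integrable (fun s => u s * b s - e s) m := by
    obtain ⟨C, hC⟩ := hu.2
    exact (D.ib.bdd_mul hu.1.aestronglyMeasurable (ae_of_all _ hC)).sub D.ie
  have su := balPrim_solution hiu (r := r) (f := u)
    (K := A - balPrim m r (fun s => w s * a s) x₀) (fun t => by rw [hu' t]; ring) (Ioo c d)
  have sw := balPrim_solution hiw (r := r) (f := w)
    (K := B - balPrim m r (fun s => u s * b s - e s) x₀) (fun t => by rw [hw' t]; ring) (Ioo c d)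
  refine ⟨u, w, isSolC_of_hasDensity isOpen_Ioo ordConnected_Ioo (hα.mono hsub) (hβ.mono hsub)
    (hη.mono hsub) (su c d).1 (sw c d).1 fun c₁ hc₁ d₁ hd₁ _ => ?_, ?_, ?_⟩
  · exact ⟨m, a, b, e, u, w, c, d, D, hc₁.1.le, hd₁.2.le, hu, hw, fun _ _ => rfl, fun _ _ => rfl,
      (su c₁ d₁).2, (sw c₁ d₁).2⟩
  · rw [hu' x₀]; ring
  · rw [hw' x₀]; ring

theorem balPrim_congr_ae (r : ℂ) {h h' : ℝ → ℂ} (H : h =ᵐ[m] h') :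
    balPrim m r h = balPrim m r h' := by
  ext t
  rw [balPrim, balPrim, integral_congr_ae (H.filter_mono (ae_mono Measure.restrict_le_self)),
    integral_congr_ae (H.filter_mono (ae_mono Measure.restrict_le_self))]

theorem IsSolC.eq_balPrim (hI : IsOpen I) (hI' : I.OrdConnected)
    (hα : LocallyBoundedVariationOn α I) (hβ : LocallyBoundedVariationOn β I)
    (hη : LocallyBoundedVariationOn η I) (h : IsSolC I r α β η u w)
    (D : DensityData m α β η a b e c d) (hc : c ∈ I) (hd : d ∈ I) (hcd : c < d) :
    (∃ C, ∀ t ∈ Ioc c d, ‖u t‖ ≤ C ∧ ‖w t‖ ≤ C) ∧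
    Integrable (fun s => w s * a s) m ∧ Integrable (fun s => u s * b s - e s) m ∧
    ∀ x₀ ∈ Ioc c d, ∀ t ∈ Ioc c d,
      u t = u x₀ + (balPrim m r (fun s => w s * a s) t -
        balPrim m r (fun s => w s * a s) x₀) ∧
      w t = w x₀ + (balPrim m r (fun s => u s * b s - e s) t -
        balPrim m r (fun s => u s * b s - e s) x₀) := by
  have := D.fin
  obtain ⟨U, W, hU, hW, huU, hwW, h1, h2⟩ :=
    h.exists_hasDensity hI hI' hα hβ hη D hc hd hcd
  have hae : ∀ᵐ x ∂m, x ∈ Icc c d := by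
    have h3 : ∀ᵐ x ∂m, x ∈ Ioc c d := by
      rw [ae_iff]
      exact D.null
    exact h3.mono fun x hx => Ioc_subset_Icc_self hx
  have ew : (fun s => W s * a s) =ᵐ[m] fun s => w s * a s := hae.mono fun s hs => by
    simp only [hwW hs]
  have eu : (fun s => U s * b s - e s) =ᵐ[m] fun s => u s * b s - e s := hae.mono fun s hs => by
    simp only [huU hs]
  obtain ⟨CU, hCU⟩ := hU.2
  obtain ⟨CW, hCW⟩ := hW.2
  have hiw : Integrable (fun s => W s * a s) m :=
    D.ia.bdd_mul hW.1.aestronglyMeasurable (ae_of_all _ hCW)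
  have hiu : Integrable (fun s => U s * b s - e s) m :=
    (D.ib.bdd_mul hU.1.aestronglyMeasurable (ae_of_all _ hCU)).sub D.ie
  refine ⟨⟨max CU CW, fun t ht => ?_⟩, hiw.congr ew, hiu.congr eu, fun x₀ hx₀ t ht => ?_⟩
  · rw [huU (Ioc_subset_Icc_self ht), hwW (Ioc_subset_Icc_self ht)]
    exact ⟨(hCU t).trans (le_max_left _ _), (hCW t).trans (le_max_right _ _)⟩
  · rw [← balPrim_congr_ae r ew, ← balPrim_congr_ae r eu,
      h1.eq_balPrim hI hI' h.1 hc hd D.null hiw ht, h1.eq_balPrim hI hI' h.1 hc hd D.null hiw hx₀,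
      h2.eq_balPrim hI hI' h.2.1 hc hd D.null hiu ht,
      h2.eq_balPrim hI hI' h.2.1 hc hd D.null hiu hx₀]
    constructor <;> ring

theorem IsSolC.unique (hI : IsOpen I) (hI' : I.OrdConnected)
    (hα : LocallyBoundedVariationOn α I) (hβ : LocallyBoundedVariationOn β I)
    (hη : LocallyBoundedVariationOn η I)
    (hθ : ∀ x ∈ I, 1 - (1 - r) ^ 2 * jumpC α x * jumpC β x ≠ 0 ∧
      1 - r ^ 2 * jumpC α x * jumpC β x ≠ 0)
    (h : IsSolC I r α β η u w) (h' : IsSolC I r α β η u' w') {x₀ : ℝ} (hx₀ : x₀ ∈ I)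
    (hu : u x₀ = u' x₀) (hw : w x₀ = w' x₀) {x : ℝ} (hx : x ∈ I) : u x = u' x ∧ w x = w' x := by
  have hmin : min x x₀ ∈ I := by
    rcases min_choice x x₀ with h | h <;> rw [h] <;> assumption
  have hd : max x x₀ ∈ I := by
    rcases max_choice x x₀ with h | h <;> rw [h] <;> assumption
  obtain ⟨c₁, c₂, hc1, hc2⟩ := mem_nhds_iff_exists_Ioo_subset.1 (hI.mem_nhds hmin)
  obtain ⟨c, hc3, hc4⟩ := exists_between hc1.1
  have hc : c ∈ I := hc2 ⟨hc3, hc4.trans hc1.2⟩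
  set d := max x x₀
  have hxm : x ∈ Ioc c d := ⟨hc4.trans_le (min_le_left _ _), le_max_left _ _⟩
  have hx₀m : x₀ ∈ Ioc c d := ⟨hc4.trans_le (min_le_right _ _), le_max_right _ _⟩
  obtain ⟨m, a, b, e, D⟩ := exists_densityData hI hI' hα hβ hη hc hd
  have := D.fin
  have hcd : c < d := hxm.1.trans_le hxm.2
  obtain ⟨⟨C, hC⟩, i1, i2, E⟩ := h.eq_balPrim hI hI' hα hβ hη D hc hd hcd
  obtain ⟨⟨C', hC'⟩, i1', i2', E'⟩ := h'.eq_balPrim hI hI' hα hβ hη D hc hd hcd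
  refine integral_solution_unique m D.ma D.mb D.ia D.ib r x₀ (D.det_ne_zero hI hI' hα hβ hc hd hθ)
    (A := u x₀) (B := w x₀) (S := Ioc c d) (C := max C C') (e := e) hx₀m ?_ ?_ i1 i2 i1' i2'
    (fun t ht => (E x₀ hx₀m t ht).1) (fun t ht => (E x₀ hx₀m t ht).2)
    (fun t ht => by rw [hu]; exact (E' x₀ hx₀m t ht).1)
    (fun t ht => by rw [hw]; exact (E' x₀ hx₀m t ht).2) x hxm
  · rintro t ht s (hs | hs)
    · exact ⟨hx₀m.1.trans hs.1, hs.2.le.trans ht.2⟩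
    · exact ⟨ht.1.trans hs.1, hs.2.le.trans hx₀m.2⟩
  · exact fun t ht => ⟨(hC t ht).1.trans (le_max_left _ _), (hC t ht).2.trans (le_max_left _ _),
      (hC' t ht).1.trans (le_max_right _ _), (hC' t ht).2.trans (le_max_right _ _)⟩

theorem IsSolC.mono {J : Set ℝ} (h : IsSolC I r α β η u w) (hJ : J ⊆ I) :
    IsSolC J r α β η u w :=
  ⟨⟨h.1.1.mono hJ, fun x hx => h.1.2 x (hJ hx)⟩, ⟨h.2.1.1.mono hJ, fun x hx => h.2.1.2 x (hJ hx)⟩,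
    measureEqOnC_iff.2 fun c hc d hd => measureEqOnC_iff.1 h.2.2.1 c (hJ hc) d (hJ hd),
    measureEqOnC_iff.2 fun c hc d hd => measureEqOnC_iff.1 h.2.2.2 c (hJ hc) d (hJ hd)⟩

theorem lims_congr {J : Set ℝ} (hJ : IsOpen J) (hJ' : J.OrdConnected)
    (hu : LocallyBoundedVariationOn u' J) (huu : EqOn u u' J) {x : ℝ} (hx : x ∈ J) :
    rightLim u x = rightLim u' x ∧ leftLim u x = leftLim u' x := by
  have h : u' =ᶠ[𝓝 x] u := by
    filter_upwards [hJ.mem_nhds hx] with y hy using (huu hy).symm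
  obtain ⟨h1, h2⟩ := hu.tendsto_lims hJ hJ' hx
  exact ⟨rightLim_eq_of_eventuallyEq h h1, leftLim_eq_of_eventuallyEq h h2⟩

theorem rBalancedC_of_local (hI : IsOpen I)
    (H : ∀ c ∈ I, ∀ d ∈ I, c < d → ∃ J u', IsOpen J ∧ J.OrdConnected ∧ c ∈ J ∧ d ∈ J ∧
      RBalancedC r J u' ∧ EqOn u u' J) : RBalancedC r I u := by
  refine ⟨fun c d hc hd => ?_, fun x hx => ?_⟩
  · rcases lt_or_ge c d with hcd | hcd
    · obtain ⟨J, u', hJ, hJ', hcJ, hdJ, hu', huu⟩ := H c hc d hd hcd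
      have hsub : I ∩ Icc c d ⊆ J ∩ Icc c d := fun x hx => ⟨hJ'.out hcJ hdJ hx.2, hx.2⟩
      refine ne_top_of_le_ne_top (hu'.1 c d hcJ hdJ) ((eVariationOn.mono _ hsub).trans ?_)
      exact (eVariationOn.congr fun x hx => huu hx.1).le
    · rw [BoundedVariationOn, eVariationOn.subsingleton]
      · exact ENNReal.zero_ne_top
      · exact (subsingleton_Icc_of_ge hcd).anti inter_subset_right
  · obtain ⟨p, q, h1, h2⟩ := mem_nhds_iff_exists_Ioo_subset.1 (hI.mem_nhds hx)
    obtain ⟨y, hy1, hy2⟩ := exists_between h1.2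
    obtain ⟨J, u', hJ, hJ', hcJ, hdJ, hu', huu⟩ := H x hx y (h2 ⟨h1.1.trans hy1, hy2⟩) hy1
    obtain ⟨h3, h4⟩ := lims_congr hJ hJ' hu'.1 huu hcJ
    rw [h3, h4, huu hcJ]
    exact hu'.2 x hcJ

theorem isSolC_of_local (hI : IsOpen I) (hI' : I.OrdConnected)
    (hα : LocallyBoundedVariationOn α I) (hβ : LocallyBoundedVariationOn β I)
    (hη : LocallyBoundedVariationOn η I)
    (H : ∀ c ∈ I, ∀ d ∈ I, c < d → ∃ J u' w', IsOpen J ∧ J.OrdConnected ∧ J ⊆ I ∧ c ∈ J ∧ d ∈ J ∧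
      IsSolC J r α β η u' w' ∧ EqOn u u' J ∧ EqOn w w' J) : IsSolC I r α β η u w := by
  refine isSolC_of_hasDensity hI hI' hα hβ hη (rBalancedC_of_local hI ?_)
    (rBalancedC_of_local hI ?_) ?_
  · intro c hc d hd hcd
    obtain ⟨J, u', w', h1, h2, h3, h4, h5, h6, h7, h8⟩ := H c hc d hd hcd
    exact ⟨J, u', h1, h2, h4, h5, h6.1, h7⟩
  · intro c hc d hd hcd
    obtain ⟨J, u', w', h1, h2, h3, h4, h5, h6, h7, h8⟩ := H c hc d hd hcd
    exact ⟨J, w', h1, h2, h4, h5, h6.2.1, h8⟩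
  · intro c hc d hd hcd
    obtain ⟨J, u', w', h1, h2, h3, h4, h5, h6, h7, h8⟩ := H c hc d hd hcd
    obtain ⟨m, a, b, e, D⟩ := exists_densityData hI hI' hα hβ hη hc hd
    obtain ⟨U, W, hU, hW, huU, hwW, du, dw⟩ := h6.exists_hasDensity h1 h2 (hα.mono h3)
      (hβ.mono h3) (hη.mono h3) D h4 h5 hcd
    have hsub := h2.out h4 h5
    refine ⟨m, a, b, e, U, W, c, d, D, le_rfl, le_rfl, hU, hW, (h7.mono hsub).trans huU,
      (h8.mono hsub).trans hwW, fun x hx y hy hxy => ?_, fun x hx y hy hxy => ?_⟩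
    · rw [(lims_congr h1 h2 h6.1.1 h7 (hsub hx)).1, (lims_congr h1 h2 h6.1.1 h7 (hsub hy)).1]
      exact du x hx y hy hxy
    · rw [(lims_congr h1 h2 h6.2.1.1 h8 (hsub hx)).1, (lims_congr h1 h2 h6.2.1.1 h8 (hsub hy)).1]
      exact dw x hx y hy hxy

theorem exists_Ioo_mem (hI : IsOpen I) {p q x : ℝ} (hp : p ∈ I) (hq : q ∈ I) (hx : x ∈ I) :
    ∃ c ∈ I, ∃ d ∈ I, p ∈ Ioo c d ∧ q ∈ Ioo c d ∧ x ∈ Ioo c d := by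
  have hmin : min p (min q x) ∈ I := by
    rcases min_choice p (min q x) with h | h <;> rw [h]
    · exact hp
    · rcases min_choice q x with h | h <;> rw [h] <;> assumption
  have hmax : max p (max q x) ∈ I := by
    rcases max_choice p (max q x) with h | h <;> rw [h]
    · exact hp
    · rcases max_choice q x with h | h <;> rw [h] <;> assumption
  obtain ⟨c₁, c₂, hc1, hc2⟩ := mem_nhds_iff_exists_Ioo_subset.1 (hI.mem_nhds hmin)
  obtain ⟨c, hc3, hc4⟩ := exists_between hc1.1
  obtain ⟨d₁, d₂, hd1, hd2⟩ := mem_nhds_iff_exists_Ioo_subset.1 (hI.mem_nhds hmax)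
  obtain ⟨d, hd3, hd4⟩ := exists_between hd1.2
  refine ⟨c, hc2 ⟨hc3, hc4.trans hc1.2⟩, d, hd2 ⟨hd1.1.trans hd3, hd4⟩, ?_⟩
  simp only [lt_min_iff, max_lt_iff] at hc4 hd3
  exact ⟨⟨hc4.1, hd3.1⟩, ⟨hc4.2.1, hd3.2.1⟩, hc4.2.2, hd3.2.2⟩

theorem exists_isSolC (hI : IsOpen I) (hI' : I.OrdConnected)
    (hα : LocallyBoundedVariationOn α I) (hβ : LocallyBoundedVariationOn β I)
    (hη : LocallyBoundedVariationOn η I)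
    (hθ : ∀ x ∈ I, 1 - (1 - r) ^ 2 * jumpC α x * jumpC β x ≠ 0 ∧
      1 - r ^ 2 * jumpC α x * jumpC β x ≠ 0) {x₀ : ℝ} (hx₀ : x₀ ∈ I) (A B : ℂ) :
    ∃ u w : ℝ → ℂ, IsSolC I r α β η u w ∧ u x₀ = A ∧ w x₀ = B := by
  have loc : ∀ p ∈ I, ∀ q ∈ I, ∃ c d, ∃ u w : ℝ → ℂ, Ioo c d ⊆ I ∧ p ∈ Ioo c d ∧ q ∈ Ioo c d ∧
      x₀ ∈ Ioo c d ∧ IsSolC (Ioo c d) r α β η u w ∧ u x₀ = A ∧ w x₀ = B := by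
    intro p hp q hq
    obtain ⟨c, hc, d, hd, h1, h2, h3⟩ := exists_Ioo_mem hI hp hq hx₀
    obtain ⟨u, w, h4, h5, h6⟩ := exists_isSolC_Ioo hI hI' hα hβ hη hθ hc hd x₀ A B
    exact ⟨c, d, u, w, Ioo_subset_Icc_self.trans (hI'.out hc hd), h1, h2, h3, h4, h5, h6⟩
  choose! cf df uf wf hsub hp _ h0 hsol hA hB using fun p hp => loc p hp p hp
  refine ⟨fun x => uf x x, fun x => wf x x,
    isSolC_of_local hI hI' hα hβ hη fun p hpI q hqI _ => ?_, hA x₀ hx₀, hB x₀ hx₀⟩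
  obtain ⟨c, d, u', w', h1, h2, h3, h4, h5, h6, h7⟩ := loc p hpI q hqI
  have key : ∀ x ∈ Ioo c d, uf x x = u' x ∧ wf x x = w' x := by
    intro x hx
    have hxI := h1 hx
    have hJ : Ioo c d ∩ Ioo (cf x) (df x) ⊆ I := inter_subset_left.trans h1
    exact IsSolC.unique (isOpen_Ioo.inter isOpen_Ioo) (ordConnected_Ioo.inter ordConnected_Ioo)
      (hα.mono hJ) (hβ.mono hJ) (hη.mono hJ) (fun y hy => hθ y (hJ hy))
      ((hsol x hxI).mono inter_subset_right) (h5.mono inter_subset_left)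
      (x₀ := x₀) ⟨h4, h0 x hxI⟩ ((hA x hxI).trans h6.symm) ((hB x hxI).trans h7.symm)
      ⟨hx, hp x hxI⟩
  exact ⟨Ioo c d, u', w', isOpen_Ioo, ordConnected_Ioo, h1, h2, h3, h5,
    fun x hx => (key x hx).1, fun x hx => (key x hx).2⟩

open ComplexConjugate in
theorem lims_conj {f : ℝ → ℂ} {x : ℝ} (hI : IsOpen I) (hI' : I.OrdConnected)
    (hf : LocallyBoundedVariationOn f I) (hx : x ∈ I) :
    rightLim (fun s => conj (f s)) x = conj (rightLim f x) ∧
      leftLim (fun s => conj (f s)) x = conj (leftLim f x) := by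
  obtain ⟨h1, h2⟩ := hf.tendsto_lims hI hI' hx
  exact ⟨rightLim_eq_of_tendsto ((Complex.continuous_conj.tendsto _).comp h1),
    leftLim_eq_of_tendsto ((Complex.continuous_conj.tendsto _).comp h2)⟩

open ComplexConjugate in
theorem HasDensity.conj {f h : ℝ → ℂ} (hI : IsOpen I) (hI' : I.OrdConnected)
    (hf : LocallyBoundedVariationOn f I) (hc : c ∈ I) (hd : d ∈ I) (hD : HasDensity m f h c d) :
    HasDensity m (fun s => conj (f s)) (fun s => conj (h s)) c d := by
  intro x hx y hy hxy
  rw [(lims_conj hI hI' hf (hI'.out hc hd hx)).1, (lims_conj hI hI' hf (hI'.out hc hd hy)).1,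
    integral_conj, ← map_sub, hD x hx y hy hxy]

open ComplexConjugate in
theorem locallyBoundedVariationOn_conj {f : ℝ → ℂ} (hf : LocallyBoundedVariationOn f I) :
    LocallyBoundedVariationOn (fun s => conj (f s)) I := by
  intro p q hp hq
  exact (Complex.conjLIE.lipschitz.comp_boundedVariationOn (hf p q hp hq))

open ComplexConjugate in
theorem HasDensity.conj_of_real {f h : ℝ → ℂ} (hI : IsOpen I) (hI' : I.OrdConnected)
    (hf : LocallyBoundedVariationOn f I) (hfr : ∀ x ∈ I, (f x).im = 0) (hc : c ∈ I) (hd : d ∈ I)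
    (hD : HasDensity m f h c d) : HasDensity m f (fun s => conj (h s)) c d := by
  have hEq : EqOn f (fun s => conj (f s)) I :=
    fun x hx => (Complex.conj_eq_iff_im.2 (hfr x hx)).symm
  intro x hx y hy hxy
  have hl := fun z (hz : z ∈ Icc c d) =>
    (lims_congr hI hI' (locallyBoundedVariationOn_conj hf) hEq (hI'.out hc hd hz)).1
  rw [hl x hx, hl y hy]
  exact hD.conj hI hI' hf hc hd x hx y hy hxy

open ComplexConjugate in
theorem BddMeas.conj {f : ℝ → ℂ} (hf : BddMeas f) : BddMeas fun s => conj (f s) :=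
  ⟨Complex.continuous_conj.comp_stronglyMeasurable hf.1,
    hf.2.imp fun C hC t => by rw [RCLike.norm_conj]; exact hC t⟩

open ComplexConjugate in
theorem IsSolC.conj (hI : IsOpen I) (hI' : I.OrdConnected)
    (hα : LocallyBoundedVariationOn α I) (hβ : LocallyBoundedVariationOn β I)
    (hη : LocallyBoundedVariationOn η I) (hr : r.im = 0)
    (hreal : ∀ x ∈ I, (α x).im = 0 ∧ (β x).im = 0 ∧ (η x).im = 0)
    (h : IsSolC I r α β η u w) :
    IsSolC I r α β η (fun s => conj (u s)) (fun s => conj (w s)) := by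
  have hbal : ∀ {f : ℝ → ℂ}, RBalancedC r I f → RBalancedC r I fun s => conj (f s) := by
    refine fun hf => ⟨locallyBoundedVariationOn_conj hf.1, fun x hx => ?_⟩
    obtain ⟨h1, h2⟩ := lims_conj hI hI' hf.1 hx
    rw [h1, h2]
    simp only [hf.2 x hx]
    simp [Complex.conj_eq_iff_im.2 hr]
  refine isSolC_of_hasDensity hI hI' hα hβ hη (hbal h.1) (hbal h.2.1) fun c hc d hd hcd => ?_
  obtain ⟨m, a, b, e, D⟩ := exists_densityData hI hI' hα hβ hη hc hd
  obtain ⟨U, W, hU, hW, huU, hwW, du, dw⟩ := h.exists_hasDensity hI hI' hα hβ hη D hc hd hcd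
  have hm : ∀ {f : ℝ → ℂ}, Measurable f → Measurable fun s => conj (f s) := fun hf =>
    Complex.continuous_conj.measurable.comp hf
  have hi : ∀ {f : ℝ → ℂ}, Integrable f m → Integrable (fun s => conj (f s)) m := fun hf =>
    Complex.conjLIE.integrable_comp_iff.2 hf
  refine ⟨m, fun s => conj (a s), fun s => conj (b s), fun s => conj (e s), fun s => conj (U s),
    fun s => conj (W s), c, d,
    ⟨D.fin, D.null, hm D.ma, hm D.mb, hm D.me, hi D.ia, hi D.ib, hi D.ie,
      D.da.conj_of_real hI hI' hα (fun x hx => (hreal x hx).1) hc hd,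
      D.db.conj_of_real hI hI' hβ (fun x hx => (hreal x hx).2.1) hc hd,
      D.de.conj_of_real hI hI' hη (fun x hx => (hreal x hx).2.2) hc hd⟩,
    le_rfl, le_rfl, hU.conj, hW.conj, fun x hx => congrArg conj (huU hx),
    fun x hx => congrArg conj (hwW hx), ?_, ?_⟩
  · simpa only [map_mul] using du.conj hI hI' h.1.1 hc hd
  · simpa only [map_mul, map_sub] using dw.conj hI hI' h.2.1.1 hc hd

end

theorem isOpen_EI (a b : EReal) : IsOpen (EI a b) :=
  isOpen_Ioo.preimage continuous_coe_real_ereal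

theorem ordConnected_EI (a b : EReal) : (EI a b).OrdConnected :=
  ⟨fun _ hx _ hy _ hz => ⟨hx.1.trans_le (EReal.coe_le_coe_iff.2 hz.1),
    (EReal.coe_le_coe_iff.2 hz.2).trans_lt hy.2⟩⟩

/-- Theorem 3.4: existence and uniqueness of `r`-balanced solutions of the
initial value problem `-d(dy/dα) + y dβ = dη`, `y(x₀) = A`, `(dy/dα)(x₀) = B`, and reality of
the solution for real data. -/
theorem statement2 (a b : EReal) (hab : a < b) (r : ℂ) (α β η : ℝ → ℂ)
    (hα : LocallyBoundedVariationOn α (EI a b))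
    (hβ : LocallyBoundedVariationOn β (EI a b))
    (hη : LocallyBoundedVariationOn η (EI a b))
    (hsupp : SuppFull (EI a b) α)
    (hθ : ∀ x ∈ EI a b,
      1 - (1 - r) ^ 2 * jumpC α x * jumpC β x ≠ 0 ∧
      1 - r ^ 2 * jumpC α x * jumpC β x ≠ 0)
    (x₀ : ℝ) (hx₀ : x₀ ∈ EI a b) (A B : ℂ) :
    (∃ u w : ℝ → ℂ, IsSolC (EI a b) r α β η u w ∧ u x₀ = A ∧ w x₀ = B) ∧
    (∀ u₁ w₁ u₂ w₂ : ℝ → ℂ,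
      IsSolC (EI a b) r α β η u₁ w₁ → u₁ x₀ = A → w₁ x₀ = B →
      IsSolC (EI a b) r α β η u₂ w₂ → u₂ x₀ = A → w₂ x₀ = B →
      ∀ x ∈ EI a b, u₁ x = u₂ x ∧ w₁ x = w₂ x) ∧
    ((r.im = 0 ∧ (∀ x ∈ EI a b, (α x).im = 0 ∧ (β x).im = 0 ∧ (η x).im = 0) ∧
        A.im = 0 ∧ B.im = 0) →
      ∀ u w : ℝ → ℂ, IsSolC (EI a b) r α β η u w → u x₀ = A → w x₀ = B →
        ∀ x ∈ EI a b, (u x).im = 0 ∧ (w x).im = 0) := by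
  have hI := isOpen_EI a b
  have hI' := ordConnected_EI a b
  refine ⟨exists_isSolC hI hI' hα hβ hη hθ hx₀ A B, ?_, ?_⟩
  · intro u₁ w₁ u₂ w₂ h₁ hu₁ hw₁ h₂ hu₂ hw₂ x hx
    exact h₁.unique hI hI' hα hβ hη hθ h₂ hx₀ (hu₁.trans hu₂.symm) (hw₁.trans hw₂.symm) hx
  · rintro ⟨hr, hreal, hA, hB⟩ u w h hu hw x hx
    have key := h.unique hI hI' hα hβ hη hθ (h.conj hI hI' hα hβ hη hr hreal) hx₀
      (by rw [hu, Complex.conj_eq_iff_im.2 hA]) (by rw [hw, Complex.conj_eq_iff_im.2 hB]) hx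
    exact ⟨Complex.conj_eq_iff_im.1 key.1.symm, Complex.conj_eq_iff_im.1 key.2.symm⟩
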